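/- arXiv:1003.5681 — 2 statements merged into one kernel-verified Lean document; each statement's English description precedes it below -/
import Mathlib

section
/- Let (L,v) be a henselian valued field of residue characteristic 0 and K a subfield with L/K algebraic. Then there exists an intermediate field L₀, algebraic over K, such that the extension of v from K to L₀ is unique, L₀ is linearly disjoint over K from the henselization K^h of K inside L, and L equals the henselization of L₀ (equivalently L = L₀·K^h). -/
section part1
open IsLocalRing Polynomial
open scoped Pointwise

/-- An integral extension of a henselian local ring with a finite group of automorphisms whose
invariants are the base is local. -/
theorem hens_isLocal_of_finite {A B G : Type*} [CommRing A] [HenselianLocalRing A] [CommRing B]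
    [IsDomain B] [Algebra A B] [Group G] [Finite G] [MulSemiringAction G B] [SMulCommClass G A B]
    [Algebra.IsInvariant A B G] (m₁ m₂ : Ideal B) [h₁ : m₁.IsMaximal] [h₂ : m₂.IsMaximal] :
    m₁ = m₂ := by
  classical
  cases nonempty_fintype G
  have : Algebra.IsIntegral A B := Algebra.IsInvariant.isIntegral A B G
  by_contra hne
  have hu : ∀ (m : Ideal B) [m.IsMaximal], m.under A = maximalIdeal A := by
    intro m hm
    have : (m.under A).IsMaximal := Ideal.isMaximal_comap_of_isIntegral_of_isMaximal m
    exact eq_maximalIdeal this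
  have hmem : ∀ (m : Ideal B) [m.IsMaximal] (x : A), algebraMap A B x ∈ m ↔ x ∈ maximalIdeal A := by
    intro m hm x
    rw [← hu m]; rfl
  obtain ⟨g₀, hg₀⟩ := Algebra.IsInvariant.exists_smul_of_under_eq A B G m₁ m₂
    ((hu m₁).trans (hu m₂).symm)
  let P := Finset.inf {g : G | g • m₁ ≠ m₁} (fun g ↦ g • m₁)
  have hmax : ∀ g : G, (g • m₁).IsMaximal := by
    intro g
    rw [Ideal.pointwise_smul_eq_comap]
    exact Ideal.comap_isMaximal_of_surjective _ (MulSemiringAction.toRingEquiv G B g⁻¹).surjective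
  have hP : ¬ P ≤ m₁ := by
    rw [Ideal.IsPrime.inf_le' inferInstance]
    rintro ⟨g, hg, hle⟩
    simp only [Finset.mem_filter, Finset.mem_univ, true_and] at hg
    exact hg ((hmax g).eq_of_le h₁.ne_top hle)
  obtain ⟨p, hpP, hpm⟩ := Set.not_subset.mp hP
  obtain ⟨c, hc⟩ : ∃ c, c * p - 1 ∈ m₁ := by
    obtain ⟨c, i, hi, hci⟩ := h₁.exists_inv hpm
    refine ⟨c, ?_⟩
    have : c * p - 1 = - i := by linear_combination hci
    rw [this]; exact m₁.neg_mem hi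
  set b := c * p with hb
  have hbo : ∀ g : G, g • m₁ ≠ m₁ → b ∈ g • m₁ := by
    intro g hg
    refine Ideal.mul_mem_left _ _ ?_
    have : P ≤ g • m₁ := Finset.inf_le (by simpa using hg)
    exact this hpP
  let D : Finset G := {g : G | g • m₁ = m₁}
  have hD : ∀ g, g ∈ D ↔ g • m₁ = m₁ := by intro g; simp [D]
  let a := ∏ d ∈ D, d • b
  have hmq : ∀ x y : B, x - y ∈ m₁ ↔ Ideal.Quotient.mk m₁ x = Ideal.Quotient.mk m₁ y :=
    fun x y => (Ideal.Quotient.eq).symm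
  have ha1 : Ideal.Quotient.mk m₁ a = 1 := by
    simp only [a, map_prod]
    refine Finset.prod_eq_one fun d hd => ?_
    rw [← map_one (Ideal.Quotient.mk m₁), ← hmq]
    have := Ideal.smul_mem_pointwise_smul d _ _ hc
    rw [(hD d).1 hd, smul_sub, smul_one] at this
    exact this
  have hao : ∀ g : G, g • m₁ ≠ m₁ → a ∈ g • m₁ := by
    intro g hg
    have h1D : (1 : G) ∈ D := by simp [hD]
    simp only [a]
    rw [← Finset.mul_prod_erase D _ h1D, one_smul]
    exact Ideal.mul_mem_right _ _ (hbo g hg)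
  have haD : ∀ g : G, g • m₁ = m₁ → g • a = a := by
    intro g hg
    simp only [a, Finset.smul_prod']
    refine Finset.prod_bij (fun d _ => g * d) ?_ ?_ ?_ ?_
    · intro d hd; rw [hD] at hd ⊢; rw [mul_smul, hd, hg]
    · intro d _ d' _ h; exact mul_left_cancel h
    · intro d hd
      refine ⟨g⁻¹ * d, ?_, by simp⟩
      rw [hD] at hd ⊢
      rw [mul_smul, hd, inv_smul_eq_iff, hg]
    · intro d hd; rw [mul_smul]
  let S : Finset B := Finset.univ.image (fun g : G => g • a)
  have haS : a ∈ S := Finset.mem_image.2 ⟨1, Finset.mem_univ _, one_smul _ _⟩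
  let f : B[X] := ∏ s ∈ S, (X - C s)
  have hf : f.Monic := monic_prod_of_monic _ _ (fun s _ => monic_X_sub_C s)
  have hfg : ∀ g : G, g • f = f := by
    intro g
    simp only [f, Finset.smul_prod', smul_sub, smul_X, smul_C]
    refine Finset.prod_bij (fun s _ => g • s) ?_ ?_ ?_ ?_
    · intro s hs
      obtain ⟨h, -, rfl⟩ := Finset.mem_image.1 hs
      exact Finset.mem_image.2 ⟨g * h, Finset.mem_univ _, mul_smul _ _ _⟩
    · intro s _ t _ h; exact smul_left_cancel g h
    · intro s hs
      obtain ⟨h, -, rfl⟩ := Finset.mem_image.1 hs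
      exact ⟨(g⁻¹ * h) • a, Finset.mem_image.2 ⟨g⁻¹ * h, Finset.mem_univ _, rfl⟩, by
        simp [mul_smul]⟩
    · intro s _; rfl
  have hlift : f ∈ Polynomial.lifts (algebraMap A B) := by
    rw [lifts_iff_coeff_lifts]
    intro n
    obtain ⟨y, hy⟩ := Algebra.IsInvariant.isInvariant (A := A) (G := G) (f.coeff n)
      (fun g => by rw [← coeff_smul, hfg])
    exact ⟨y, hy⟩
  obtain ⟨q, hqf, -, hqm⟩ := lifts_and_natDegree_eq_and_monic hlift hf
  let g := ∏ s ∈ S.erase a, (X - C s)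
  have hfa : f = (X - C a) * g := (Finset.mul_prod_erase S _ haS).symm
  have hother : ∀ s ∈ S.erase a, Ideal.Quotient.mk m₁ s = 0 := by
    intro s hs
    obtain ⟨hsa, hs⟩ := Finset.mem_erase.1 hs
    obtain ⟨h, -, rfl⟩ := Finset.mem_image.1 hs
    have h1 : h • m₁ ≠ m₁ := fun e => hsa (haD h e)
    have h2 : h⁻¹ • m₁ ≠ m₁ := fun e => h1 (by rw [← inv_smul_eq_iff.1 e])
    have h3 := Ideal.smul_mem_pointwise_smul h _ _ (hao _ h2)
    rw [smul_inv_smul] at h3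
    exact Ideal.Quotient.eq_zero_iff_mem.2 h3
  have hfmap : f.map (Ideal.Quotient.mk m₁) = (X - 1) * X ^ (S.erase a).card := by
    rw [hfa, Polynomial.map_mul, Polynomial.map_prod, Finset.prod_congr rfl (g := fun _ => X)]
    · simp [ha1]
    · intro s hs
      simp [hother s hs]
  have he1 : Ideal.Quotient.mk m₁ (f.eval 1) = 0 := by
    rw [← eval_map_apply, hfmap]
    simp
  have he2 : Ideal.Quotient.mk m₁ (f.derivative.eval 1) = 1 := by
    rw [← eval_map_apply, ← derivative_map, hfmap]
    simp
  have hq1 : algebraMap A B (q.eval 1) = f.eval 1 := by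
    rw [← hqf, ← eval_map_apply, map_one]
  have hq2 : algebraMap A B (q.derivative.eval 1) = f.derivative.eval 1 := by
    rw [← hqf, ← eval_map_apply, map_one, derivative_map]
  obtain ⟨α, hα, hα1⟩ := HenselianLocalRing.is_henselian q hqm 1
    (by rw [← hmem m₁, hq1]; exact Ideal.Quotient.eq_zero_iff_mem.1 he1)
    (by
      by_contra hnu
      have := (hmem m₁ _).2 ((mem_maximalIdeal _).2 hnu)
      rw [hq2, ← Ideal.Quotient.eq_zero_iff_mem, he2] at this
      exact one_ne_zero this)
  have hroot : f.eval (algebraMap A B α) = 0 := by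
    rw [← hqf, eval_map_apply, hα.eq_zero, map_zero]
  simp only [f, eval_prod, Finset.prod_eq_zero_iff] at hroot
  obtain ⟨s, hs, hs0⟩ := hroot
  obtain ⟨h, -, rfl⟩ := Finset.mem_image.1 hs
  have hαa : a = algebraMap A B α := by
    have : algebraMap A B α = h • a := by simpa [sub_eq_zero] using hs0
    rw [← inv_smul_eq_iff] at this
    rw [← this, smul_algebraMap]
  have : α ∈ maximalIdeal A := by
    rw [← hmem m₂, ← hαa, hg₀]
    exact hao g₀ (by rw [← hg₀]; exact Ne.symm hne)
  have h1 : (1 : A) ∈ maximalIdeal A := by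
    have := (maximalIdeal A).sub_mem this hα1
    simpa using this
  exact (Ideal.ne_top_iff_one _).1 (maximalIdeal.isMaximal A).ne_top h1

end part1

section part2
open IsLocalRing Polynomial
open scoped Pointwise

/-- Division of a root relation from the top. -/
theorem integral_tail {A N : Type*} [CommRing A] [Field N] [Algebra A N] (x : N) (k : ℕ) :
    ∀ (n : ℕ) (c : ℕ → N), (∀ i, IsIntegral A (c i)) → c k = 1 → k ≤ n →
      ∑ i ∈ Finset.range (n + 1), c i * x ^ i = 0 →
    ∃ u w : N, IsIntegral A u ∧ IsIntegral A w ∧ IsIntegral A (x * u) ∧ IsIntegral A (x * w) ∧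
      u - x * w = 1 := by
  have key : ∀ (n : ℕ) (c : ℕ → N), (∀ i, IsIntegral A (c i)) →
      ∑ i ∈ Finset.range (n + 1), c i * x ^ i = 0 → IsIntegral A (x * c n) := by
    intro n c hc h
    let c' : ℕ → integralClosure A N := fun i => ⟨c i, hc i⟩
    let p : (integralClosure A N)[X] := ∑ i ∈ Finset.range (n + 1), C (c' i) * X ^ i
    by_cases h0 : c n = 0
    · rw [h0, mul_zero]; exact isIntegral_zero
    have hcoeff : p.coeff n = c' n := by
      simp [p, coeff_C_mul, coeff_X_pow]
    have hdeg : p.natDegree ≤ n := by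
      refine natDegree_sum_le_of_forall_le _ _ fun i hi => ?_
      refine (natDegree_C_mul_X_pow_le _ _).trans ?_
      simp at hi; omega
    have hne : c' n ≠ 0 := fun e => h0 (congrArg Subtype.val e)
    have hnd : p.natDegree = n :=
      le_antisymm hdeg (le_natDegree_of_ne_zero (by rwa [hcoeff]))
    have hl : p.leadingCoeff = c' n := by rw [leadingCoeff, hnd, hcoeff]
    have hx : aeval x p = 0 := by
      simp only [p, map_sum, map_mul, aeval_C, map_pow, aeval_X]
      exact h
    have := isIntegral_leadingCoeff_smul p x hx
    rw [hl] at this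
    have h2 := isIntegral_trans (R := A) (A := integralClosure A N) _ this
    rw [Algebra.smul_def] at h2
    rw [mul_comm]; exact h2
  intro n
  induction n with
  | zero =>
    intro c hc hk hkn h
    obtain rfl : k = 0 := by omega
    simp [hk] at h
  | succ n ih =>
    intro c hc hk hkn h
    have hi := key _ c hc h
    have hs : ∑ i ∈ Finset.range (n + 1), (Function.update c n (c n + x * c (n + 1))) i * x ^ i = 0 := by
      rw [Finset.sum_range_succ] at h ⊢
      rw [Finset.sum_range_succ] at h
      rw [Finset.sum_congr rfl (g := fun i => c i * x ^ i)]
      · rw [← h]; simp; ring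
      · intro i hi
        simp at hi
        rw [Function.update_of_ne (by omega)]
    have hint : ∀ i, IsIntegral A ((Function.update c n (c n + x * c (n + 1))) i) := by
      intro i
      by_cases hin : i = n
      · subst hin; simp; exact (hc _).add hi
      · rw [Function.update_of_ne hin]; exact hc i
    rcases Nat.lt_or_ge n k with hnk | hnk
    · obtain rfl : k = n + 1 := by omega
      refine ⟨1, 0, isIntegral_one, isIntegral_zero, ?_, by simpa using isIntegral_zero, by simp⟩
      rw [← hk]; exact hi
    · rcases Nat.lt_or_ge k n with h1 | h1
      · exact ih _ hint (by rw [Function.update_of_ne (by omega), hk]) hnk hs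
      · obtain rfl : k = n := by omega
        have hj := key _ _ hint hs
        have hu := hint k
        simp only [Function.update_self] at hj hu
        exact ⟨c k + x * c (k + 1), c (k + 1), hu, hc _, hj, hi, by rw [hk]; ring⟩

theorem exists_uw {A F N : Type*} [CommRing A] [IsDomain A] [ValuationRing A] [Field F]
    [Algebra A F] [IsFractionRing A F] [Field N] [Algebra F N] [Algebra A N] [IsScalarTower A F N]
    [Algebra.IsAlgebraic F N] (x : N) :
    ∃ u w : N, IsIntegral A u ∧ IsIntegral A w ∧ IsIntegral A (x * u) ∧ IsIntegral A (x * w) ∧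
      u - x * w = 1 := by
  classical
  have hx : IsAlgebraic A x :=
    (IsFractionRing.isAlgebraic_iff A F N).2 (Algebra.IsAlgebraic.isAlgebraic x)
  obtain ⟨p, hp0, hp⟩ := hx
  obtain ⟨k, hk, hdiv⟩ : ∃ k ∈ p.support, ∀ i ∈ p.support, p.coeff k ∣ p.coeff i := by
    have hne : p.support.Nonempty := by simpa using hp0
    have : ∀ s : Finset ℕ, s.Nonempty → ∃ k ∈ s, ∀ i ∈ s, p.coeff k ∣ p.coeff i := by
      intro s hs
      induction hs using Finset.Nonempty.cons_induction with
      | singleton a => exact ⟨a, by simp, by simp⟩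
      | cons a s ha hs ih =>
        obtain ⟨k, hk, h⟩ := ih
        rcases ValuationRing.dvd_total (p.coeff k) (p.coeff a) with h1 | h1
        · refine ⟨k, by simp [hk], fun i hi => ?_⟩
          rcases Finset.mem_cons.1 hi with rfl | hi
          · exact h1
          · exact h i hi
        · refine ⟨a, by simp, fun i hi => ?_⟩
          rcases Finset.mem_cons.1 hi with rfl | hi
          · exact dvd_rfl
          · exact h1.trans (h i hi)
    exact this _ hne
  have hdiv' : ∀ i, ∃ d, p.coeff i = p.coeff k * d := by
    intro i
    by_cases hi : i ∈ p.support
    · exact hdiv i hi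
    · exact ⟨0, by simpa using hi⟩
  choose d hd using hdiv'
  have hk0 : p.coeff k ≠ 0 := by simpa using hk
  have hdk : d k = 1 := by
    have := hd k
    exact mul_left_cancel₀ hk0 (by rw [← this, mul_one])
  have hinj : Function.Injective (algebraMap A N) := by
    rw [IsScalarTower.algebraMap_eq A F N]
    exact (algebraMap F N).injective.comp (IsFractionRing.injective A F)
  refine integral_tail (A := A) x k p.natDegree (fun i => algebraMap A N (d i))
    (fun i => isIntegral_algebraMap) (by simp [hdk]) (le_natDegree_of_ne_zero hk0) ?_
  have h0 : algebraMap A N (p.coeff k) ≠ 0 := by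
    rw [Ne, map_eq_zero_iff _ hinj]; exact hk0
  refine mul_left_cancel₀ h0 ?_
  rw [mul_zero, Finset.mul_sum, ← hp, aeval_eq_sum_range]
  refine Finset.sum_congr rfl fun i _ => ?_
  rw [Algebra.smul_def, hd i, map_mul]; ring

/-- `x` or `1 - x` is a unit in the integral closure of a henselian valuation ring. -/
theorem hens_inv {A F N : Type*} [CommRing A] [IsDomain A] [IsIntegrallyClosed A]
    [HenselianLocalRing A] [Field F]
    [Algebra A F] [IsFractionRing A F] [Field N] [Algebra F N] [Algebra A N] [IsScalarTower A F N]
    [IsGalois F N] (x : N) (hx : IsIntegral A x) :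
    IsIntegral A x⁻¹ ∨ IsIntegral A (1 - x)⁻¹ := by
  let E := FiniteGaloisIntermediateField.adjoin F ({x} : Set N)
  have hxE : x ∈ E.toIntermediateField :=
    FiniteGaloisIntermediateField.subset_adjoin F {x} (Set.mem_singleton x)
  let B := integralClosure A E
  have : IsFractionRing B E := integralClosure.isFractionRing_of_finite_extension F E
  let _ := IsIntegralClosure.MulSemiringAction A F E B
  have := Algebra.isInvariant_of_isGalois A F E B
  have hloc : ∀ m₁ m₂ : Ideal B, m₁.IsMaximal → m₂.IsMaximal → m₁ = m₂ := by
    intro m₁ m₂ h₁ h₂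
    have : SMulCommClass Gal(E/F) A B := ⟨fun g a b => by
      change galRestrict A F E B g (a • b) = a • galRestrict A F E B g b
      exact map_smul _ _ _⟩
    exact hens_isLocal_of_finite (A := A) (G := Gal(E/F)) m₁ m₂
  have : IsScalarTower A E N := IsScalarTower.to₁₃₄ A F E N
  have hinjE : Function.Injective (algebraMap E N) := (algebraMap E N).injective
  let y : B := ⟨⟨x, hxE⟩, (isIntegral_algebraMap_iff (B := N) hinjE).1 hx⟩
  have hyx : algebraMap E N y.1 = x := rfl
  have hunit : ∀ z : B, IsUnit z → IsIntegral A (algebraMap E N z.1)⁻¹ := by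
    rintro z ⟨⟨z, t, h, h'⟩, rfl⟩
    have h1 : z.1 * t.1 = 1 := congrArg Subtype.val h
    have : (algebraMap E N z.1)⁻¹ = algebraMap E N t.1 := by
      exact inv_eq_of_mul_eq_one_right (by rw [← map_mul, h1, map_one])
    rw [this]
    exact (isIntegral_algebraMap_iff (B := N) hinjE).2 t.2
  by_cases h1 : IsUnit y
  · left; rw [← hyx]; exact hunit y h1
  by_cases h2 : IsUnit (1 - y)
  · right
    have := hunit _ h2
    exact this
  exfalso
  obtain ⟨m₁, hm₁, hy₁⟩ := exists_max_ideal_of_mem_nonunits h1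
  obtain ⟨m₂, hm₂, hy₂⟩ := exists_max_ideal_of_mem_nonunits h2
  obtain rfl := hloc _ _ hm₁ hm₂
  exact (Ideal.ne_top_iff_one _).1 hm₁.ne_top (by simpa using m₁.add_mem hy₁ hy₂)

theorem hens_val {A F N : Type*} [CommRing A] [IsDomain A] [ValuationRing A]
    [HenselianLocalRing A] [Field F]
    [Algebra A F] [IsFractionRing A F] [Field N] [Algebra F N] [Algebra A N] [IsScalarTower A F N]
    [IsGalois F N] (x : N) :
    IsIntegral A x ∨ IsIntegral A x⁻¹ := by
  obtain ⟨u, w, hu, hw, hxu, hxw, h⟩ := exists_uw (A := A) (F := F) x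
  rcases hens_inv (F := F) u hu with h1 | h1
  · by_cases h0 : u = 0
    · right
      have : x * w = -1 := by rw [← h, h0]; ring
      have h2 : x⁻¹ = -w := inv_eq_of_mul_eq_one_right (by linear_combination -this)
      rw [h2]; exact hw.neg
    · left
      have : x = x * u * u⁻¹ := by field_simp
      rw [this]; exact hxu.mul h1
  · have h3 : 1 - u = - (x * w) := by rw [← h]; ring
    rw [h3] at h1
    by_cases h0 : x * w = 0
    · left
      have : u = 1 := by rw [← h, h0]; ring
      simpa [this] using hxu
    · right
      have : x⁻¹ = - w * (-(x * w))⁻¹ := by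
        have := left_ne_zero_of_mul h0
        have := right_ne_zero_of_mul h0
        field_simp
      rw [this]; exact hw.neg.mul h1

end part2

section part3
open IsLocalRing Polynomial
open scoped Pointwise

theorem val_le_one_of_isIntegral {A N Γ : Type*} [CommRing A] [Field N] [Algebra A N]
    [LinearOrderedCommGroupWithZero Γ] (w : Valuation N Γ)
    (hA : ∀ a : A, w (algebraMap A N a) ≤ 1) {x : N} (hx : IsIntegral A x) : w x ≤ 1 := by
  obtain ⟨p, hp, hpx⟩ := hx
  let φ : A →+* w.integer := (algebraMap A N).codRestrict w.integer hA
  have h := (Valuation.integer.integers w).isIntegral_iff_v_le_one (x := x)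
  rw [← h]
  refine ⟨p.map φ, hp.map _, ?_⟩
  rw [eval₂_map]
  exact hpx

/-- The prime of the integral closure below a valuation subring. -/
def primeOf {A N : Type*} [CommRing A] [Field N] [Algebra A N] (W : ValuationSubring N)
    (hA : ∀ a : A, algebraMap A N a ∈ W) : Ideal (integralClosure A N) where
  carrier := {b | W.valuation b.1 < 1}
  add_mem' := by
    intro a b ha hb
    exact (W.valuation.map_add_lt ha hb)
  zero_mem' := by simp
  smul_mem' := by
    intro c x hx
    have : W.valuation c.1 ≤ 1 := val_le_one_of_isIntegral (A := A) _
      (fun a => (W.valuation_le_one_iff _).2 (hA a)) c.2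
    change W.valuation (c.1 * x.1) < 1
    rw [map_mul]
    exact lt_of_le_of_lt (mul_le_of_le_one_left' this) hx

theorem exists_conj {F N : Type*} [Field F] [Field N] [Algebra F N] [IsGalois F N]
    (O : ValuationSubring F) (W₁ W₂ : ValuationSubring N)
    (h₁ : ∀ a : F, algebraMap F N a ∈ W₁ ↔ a ∈ O) (h₂ : ∀ a : F, algebraMap F N a ∈ W₂ ↔ a ∈ O) :
    ∃ ρ : Gal(N/F), ∀ x, x ∈ W₁ ↔ ρ x ∈ W₂ := by
  let B := integralClosure O N
  have hAN : ∀ a : O, algebraMap O N a = algebraMap F N a.1 := fun a => rfl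
  have hA₁ : ∀ a : O, algebraMap O N a ∈ W₁ := fun a => (h₁ a.1).2 a.2
  have hA₂ : ∀ a : O, algebraMap O N a ∈ W₂ := fun a => (h₂ a.1).2 a.2
  have hle : ∀ (W : ValuationSubring N), (∀ a : O, algebraMap O N a ∈ W) → ∀ x : N,
      IsIntegral O x → x ∈ W := fun W hW x hx => (W.valuation_le_one_iff _).1
    (val_le_one_of_isIntegral (A := O) _ (fun a => (W.valuation_le_one_iff _).2 (hW a)) hx)
  let P₁ : Ideal B := primeOf W₁ hA₁
  let P₂ : Ideal B := primeOf W₂ hA₂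
  have hm₁ : ∀ b : B, b ∈ P₁ ↔ W₁.valuation b.1 < 1 := fun b => Iff.rfl
  have hm₂ : ∀ b : B, b ∈ P₂ ↔ W₂.valuation b.1 < 1 := fun b => Iff.rfl
  have hprime : ∀ (W : ValuationSubring N) (hW : ∀ a : O, algebraMap O N a ∈ W),
      (primeOf W hW).IsPrime := by
    intro W hW
    constructor
    · rw [Ideal.ne_top_iff_one]
      change ¬ (W.valuation (1 : N) < 1)
      simp
    · intro x y hxy
      change W.valuation (x.1 * y.1) < 1 at hxy
      change W.valuation x.1 < 1 ∨ W.valuation y.1 < 1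
      by_contra! hcon
      rw [map_mul] at hxy
      exact absurd hxy (not_lt.2 (one_le_mul hcon.1 hcon.2))
  have := hprime W₁ hA₁
  have := hprime W₂ hA₂
  have hunder : ∀ (W : ValuationSubring N) (hW : ∀ a : O, algebraMap O N a ∈ W)
      (hW' : ∀ a : F, algebraMap F N a ∈ W ↔ a ∈ O),
      (primeOf W hW).under O = maximalIdeal O := by
    intro W hW hW'
    ext a
    rw [mem_maximalIdeal, mem_nonunits_iff, O.valuation_eq_one_iff]
    change W.valuation (algebraMap F N a.1) < 1 ↔ _
    have e1 : (W.valuation (algebraMap F N a.1) < 1) ↔ ¬ ((algebraMap F N a.1)⁻¹ ∈ W ∧ a.1 ≠ 0) := by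
      by_cases h0 : a.1 = 0
      · simp [h0]
      · rw [← W.valuation_le_one_iff, map_inv₀, inv_le_one₀, not_and_or]
        · simp [h0]
        · simpa [zero_lt_iff] using h0
    rw [e1, ← map_inv₀, hW', ← O.valuation_le_one_iff]
    have h1 := O.valuation_le_one a
    by_cases h0 : a.1 = 0
    · simp [h0]
    · rw [map_inv₀, inv_le_one₀ (by simpa [zero_lt_iff] using h0)]
      simp only [ne_eq, h0, not_false_eq_true, and_true, not_iff_not]
      exact ⟨fun h => le_antisymm h1 h, fun h => h.ge⟩
  have : Algebra.IsAlgebraic O N := ⟨fun x => (IsFractionRing.isAlgebraic_iff O F N).2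
    (Algebra.IsAlgebraic.isAlgebraic x)⟩
  have hfrac : IsFractionRing B N := integralClosure.isFractionRing_of_algebraic
    (A := O) (fun x hx => by
      rw [hAN] at hx
      exact Subtype.ext (by simpa using hx))
  let _ := IsIntegralClosure.MulSemiringAction O F N B
  have hsmul : ∀ (g : Gal(N/F)) (b : B), (g • b).1 = g b.1 := fun g b =>
    algebraMap_galRestrict_apply O g b
  have : SMulCommClass Gal(N/F) O B := ⟨fun g a b => by
      change galRestrict O F N B g (a • b) = a • galRestrict O F N B g b
      exact map_smul _ _ _⟩
  have : Algebra.IsInvariant O B Gal(N/F) := by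
    constructor
    intro b hb
    have : b.1 ∈ Set.range (algebraMap F N) := by
      rw [InfiniteGalois.mem_range_algebraMap_iff_fixed]
      intro g
      rw [← hsmul, hb]
    obtain ⟨a, ha⟩ := this
    have haO : a ∈ O := (h₁ a).1 (by rw [ha]; exact hle W₁ hA₁ _ b.2)
    exact ⟨⟨a, haO⟩, Subtype.ext ha⟩
  let _ : TopologicalSpace B := ⊥
  have : DiscreteTopology B := ⟨rfl⟩
  have : ContinuousSMul Gal(N/F) B := by
    refine (continuousSMul_iff_stabilizer_isOpen (M := Gal(N/F)) (X := B)).2 fun b => ?_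
    have := stabilizer_isOpen_of_isIntegral (K := F) b.1
    convert! this using 1
    ext g
    simp only [SetLike.mem_coe, MulAction.mem_stabilizer_iff]
    rw [← Subtype.coe_inj, hsmul]
    rfl
  obtain ⟨ρ, hρ⟩ := Algebra.IsInvariant.exists_smul_of_under_eq_of_profinite (A := O)
    (G := Gal(N/F)) P₁ P₂ ((hunder W₁ hA₁ h₁).trans (hunder W₂ hA₂ h₂).symm)
  -- ρ P₁ = P₂
  have hPρ : ∀ b : B, b ∈ P₁ ↔ ρ • b ∈ P₂ := by
    intro b
    rw [hρ, Ideal.smul_mem_pointwise_smul_iff]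
  have key : ∀ (W W' : ValuationSubring N) (hW : ∀ a : O, algebraMap O N a ∈ W)
      (hW' : ∀ a : O, algebraMap O N a ∈ W') (g : Gal(N/F)),
      (∀ b : B, b ∈ primeOf W hW ↔ g • b ∈ primeOf W' hW') → ∀ x, x ∈ W → g x ∈ W' := by
    intro W W' hW hW' g hg x hx
    have hstep : ∀ s : N, IsIntegral O s → IsIntegral O (x * s) → ¬ (W.valuation s < 1) →
        g x ∈ W' := by
      intro s hs hxs h1
      have h2 : ¬ (W'.valuation (g s) < 1) := by
        intro h3
        apply h1
        refine (hg ⟨s, hs⟩).2 ?_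
        change W'.valuation (g • (⟨s, hs⟩ : B)).1 < 1
        rw [hsmul]; exact h3
      have h3 : g (x * s) ∈ W' := by
        have := hle W' hW' _ (g • (⟨x * s, hxs⟩ : B)).2
        rwa [hsmul] at this
      rw [← W'.valuation_le_one_iff, map_mul, map_mul] at h3
      rw [← W'.valuation_le_one_iff]
      by_contra! h4
      exact absurd h3 (not_le.2 (one_lt_mul_of_lt_of_le h4 (not_lt.1 h2)))
    obtain ⟨u, w, hu, hw, hxu, hxw, h⟩ := exists_uw (A := O) (F := F) x
    by_cases hu1 : W.valuation u < 1
    · by_cases hw1 : W.valuation w < 1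
      · exfalso
        have hx1 := (W.valuation_le_one_iff _).2 hx
        have : W.valuation (u - x * w) < 1 := by
          refine (W.valuation.map_sub_lt hu1 ?_)
          rw [map_mul]
          exact lt_of_le_of_lt (mul_le_of_le_one_left' hx1) hw1
        rw [h, map_one] at this
        exact lt_irrefl _ this
      · exact hstep w hw hxw hw1
    · exact hstep u hu hxu hu1
  refine ⟨ρ, fun x => ⟨key W₁ W₂ hA₁ hA₂ ρ hPρ x, fun hx => ?_⟩⟩
  have := key W₂ W₁ hA₂ hA₁ ρ⁻¹ (fun b => by
    have := hPρ (ρ⁻¹ • b)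
    rw [smul_inv_smul] at this
    exact this.symm) _ hx
  simpa using this

end part3

section part4
open IsLocalRing Polynomial
open scoped Pointwise

section hensel
variable {M Γ : Type*} [Field M] [LinearOrderedCommGroupWithZero Γ] (v : Valuation M Γ)

theorem isUnit_vsub (a : v.valuationSubring) : IsUnit a ↔ v a.1 = 1 := by
  constructor
  · rintro ⟨⟨a, b, h, h'⟩, rfl⟩
    have h1 : v a.1 ≤ 1 := a.2
    have h2 : v b.1 ≤ 1 := b.2
    have h3 : a.1 * b.1 = 1 := congrArg Subtype.val h
    have h4 : v a.1 * v b.1 = 1 := by rw [← map_mul, h3, map_one]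
    refine le_antisymm h1 ?_
    rw [← h4]
    exact mul_le_of_le_one_right' h2
  · intro h
    have h0 : a.1 ≠ 0 := by
      intro h0; rw [h0, map_zero] at h; exact zero_ne_one h
    refine IsUnit.of_mul_eq_one ⟨a.1⁻¹, ?_⟩ (Subtype.ext (mul_inv_cancel₀ h0))
    change v a.1⁻¹ ≤ 1
    rw [map_inv₀, h, inv_one]

theorem mem_max_vsub (a : v.valuationSubring) : a ∈ maximalIdeal v.valuationSubring ↔ v a.1 < 1 := by
  rw [mem_maximalIdeal, mem_nonunits_iff, isUnit_vsub]
  have h : v a.1 ≤ 1 := a.2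
  exact ⟨fun h' => lt_of_le_of_ne h h', fun h' => h'.ne⟩

theorem v_eval_le {f : M[X]} (hf : ∀ i, v (f.coeff i) ≤ 1) {x : M} (hx : v x ≤ 1) :
    v (f.eval x) ≤ 1 := by
  rw [eval_eq_sum_range]
  refine v.map_sum_le fun i _ => ?_
  rw [map_mul, map_pow]
  exact mul_le_one' (hf i) (pow_le_one' hx i)

theorem hensel_apply (h : HenselianLocalRing v.valuationSubring) (f : M[X]) (hm : f.Monic)
    (hf : ∀ i, v (f.coeff i) ≤ 1) (a₀ : M) (ha₀ : v a₀ ≤ 1) (h1 : v (f.eval a₀) < 1)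
    (h2 : v (f.derivative.eval a₀) = 1) : ∃ a, f.eval a = 0 ∧ v (a - a₀) < 1 := by
  have hl : f ∈ Polynomial.lifts v.valuationSubring.subtype := by
    rw [lifts_iff_coeff_lifts]
    intro n
    exact ⟨⟨f.coeff n, hf n⟩, rfl⟩
  obtain ⟨q, hqf, -, hqm⟩ := lifts_and_natDegree_eq_and_monic hl hm
  have e : ∀ (q : (v.valuationSubring)[X]) (b : v.valuationSubring),
      (q.map v.valuationSubring.subtype).eval b.1 = (q.eval b).1 := by
    intro q b
    exact eval_map_apply (f := v.valuationSubring.subtype) (p := q) (x := b)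
  obtain ⟨a, ha, ha'⟩ := h.is_henselian q hqm ⟨a₀, ha₀⟩
    (by rw [mem_max_vsub, ← e, hqf]; exact h1)
    (by rw [isUnit_vsub, ← e, ← derivative_map, hqf]; exact h2)
  refine ⟨a.1, ?_, ?_⟩
  · rw [← hqf, e, ha.eq_zero]; rfl
  · exact (mem_max_vsub v _).1 ha'

theorem hensel_of (h : ∀ (f : M[X]), f.Monic →
    (∀ i, v (f.coeff i) ≤ 1) → ∀ (a₀ : M), v a₀ ≤ 1 → v (f.eval a₀) < 1 →
    v (f.derivative.eval a₀) = 1 → ∃ a, f.eval a = 0 ∧ v (a - a₀) < 1) :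
    HenselianLocalRing v.valuationSubring := by
  constructor
  intro q hqm a₀ h1 h2
  have e : ∀ (q : (v.valuationSubring)[X]) (b : v.valuationSubring),
      (q.map v.valuationSubring.subtype).eval b.1 = (q.eval b).1 := by
    intro q b
    exact eval_map_apply (f := v.valuationSubring.subtype) (p := q) (x := b)
  obtain ⟨a, ha, ha'⟩ := h (q.map v.valuationSubring.subtype) (hqm.map _) (fun i => by
    rw [coeff_map]; exact (q.coeff i).2) a₀.1 a₀.2
    (by rw [e]; exact (mem_max_vsub v _).1 h1)
    (by rw [derivative_map, e]; exact (isUnit_vsub v _).1 h2)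
  have hva : v a ≤ 1 := by
    have : a = (a - a₀.1) + a₀.1 := by ring
    rw [this]
    exact v.map_add_le ha'.le a₀.2
  refine ⟨⟨a, hva⟩, ?_, ?_⟩
  · have := e q ⟨a, hva⟩
    rw [ha] at this
    exact Subtype.ext this.symm
  · exact (mem_max_vsub v _).2 ha'

theorem natCast_v (hchar : CharZero (ResidueField ↥v.valuationSubring)) (n : ℕ) (hn : n ≠ 0) :
    v (n : M) = 1 := by
  have h1 : IsUnit (n : v.valuationSubring) := by
    by_contra hcon
    have := (residue_eq_zero_iff (n : v.valuationSubring)).2 ((mem_maximalIdeal _).2 hcon)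
    rw [map_natCast] at this
    exact hn (by exact_mod_cast this)
  have := (isUnit_vsub v _).1 h1
  simpa using this

theorem v_sum_distinct {ι : Type*} (s : Finset ι) (t : ι → M)
    (h : ∀ i ∈ s, ∀ j ∈ s, t i ≠ 0 → v (t i) = v (t j) → i = j) :
    ∀ i ∈ s, v (t i) ≤ v (∑ i ∈ s, t i) := by
  classical
  intro i hi
  obtain ⟨k, hk, hmax⟩ := s.exists_max_image (fun i => v (t i)) ⟨i, hi⟩
  refine (hmax i hi).trans ?_
  by_cases h0 : t k = 0
  · rw [h0, map_zero]; exact zero_le'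
  rw [← Finset.add_sum_erase s _ hk, v.map_add_eq_of_lt_left]
  refine v.map_sum_lt (by simpa using h0) fun j hj => ?_
  rw [Finset.mem_erase] at hj
  refine lt_of_le_of_ne (hmax j hj.2) fun e => hj.1 ?_
  exact (h k hk j hj.2 h0 e.symm).symm

end hensel

end part4

section part5
open IsLocalRing Polynomial IntermediateField
open scoped Pointwise

section steps
variable {E L Γ : Type*} [Field E] [Field L] [Algebra E L] [LinearOrderedCommGroupWithZero Γ]
  (v : Valuation L Γ)

theorem mem_adjoin_poly (a : L) (f : E[X]) (hf : f.Monic) (hfa : aeval a f = 0)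
    (y : L) (hy : y ∈ E⟮a⟯) : ∃ g : E[X], g.natDegree < f.natDegree ∧ aeval a g = y := by
  have hint : IsIntegral E a := ⟨f, hf, hfa⟩
  have hf1 : f ≠ 1 := by rintro rfl; simp at hfa
  rw [← IntermediateField.mem_toSubalgebra,
    IntermediateField.adjoin_simple_toSubalgebra_of_isAlgebraic hint.isAlgebraic,
    Algebra.adjoin_singleton_eq_range_aeval] at hy
  obtain ⟨p, rfl⟩ := hy
  refine ⟨p %ₘ f, natDegree_modByMonic_lt _ hf hf1, ?_⟩
  conv_rhs => rw [← modByMonic_add_div p f]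
  simp [hfa]

theorem exists_pow_eq [Algebra.IsAlgebraic E L] (x : L) (hx : x ≠ 0) :
    ∃ n : ℕ, n ≠ 0 ∧ ∃ c : E, c ≠ 0 ∧ v x ^ n = v (algebraMap E L c) := by
  obtain ⟨p, hp0, hp⟩ := Algebra.IsAlgebraic.isAlgebraic (R := E) x
  by_contra! hcon
  rw [aeval_eq_sum_range] at hp
  have key := v_sum_distinct v (Finset.range (p.natDegree + 1)) (fun i => p.coeff i • x ^ i) (by
    have main : ∀ i j : ℕ, i < j → p.coeff i ≠ 0 → p.coeff j ≠ 0 →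
        v (p.coeff i • x ^ i) = v (p.coeff j • x ^ j) → False := by
      intro i j hij h1 h2 e
      refine hcon (j - i) (by omega) (p.coeff i / p.coeff j) (div_ne_zero h1 h2) ?_
      obtain ⟨k, rfl⟩ := Nat.exists_eq_add_of_lt hij
      have hvx : v x ≠ 0 := by simpa using hx
      have hvj : v (algebraMap E L (p.coeff (i + k + 1))) ≠ 0 := by simpa using h2
      simp only [Algebra.smul_def, map_mul, map_pow] at e
      rw [map_div₀, map_div₀, eq_div_iff hvj]
      have : i + k + 1 - i = k + 1 := by omega
      rw [this]
      apply mul_right_cancel₀ (pow_ne_zero i hvx)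
      rw [e, show i + k + 1 = (k + 1) + i by omega, pow_add (v x) (k + 1) i, ← mul_assoc,
        mul_comm (v x ^ (k + 1))]
    intro i _ j _ h0 e
    have h1 : p.coeff i ≠ 0 := by intro h; simp [h] at h0
    have h2 : p.coeff j ≠ 0 := by
      intro h
      simp only [h, zero_smul, map_zero, map_eq_zero] at e
      exact h0 e
    rcases lt_trichotomy i j with h | h | h
    · exact (main i j h h1 h2 e).elim
    · exact h
    · exact (main j i h h2 h1 e.symm).elim) p.natDegree (by simp)
  rw [hp] at key
  simp only [map_zero, le_zero_iff, map_eq_zero, Algebra.smul_def, mul_eq_zero] at key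
  rcases key with h | h
  · exact hp0 (by simpa using h)
  · exact hx (eq_zero_of_pow_eq_zero h)

/-- Truncation: make a polynomial monic. -/
theorem trunc (x : L) (hx : v x ≤ 1) : ∀ (n : ℕ) (g : E[X]), g.support.card ≤ n →
    (∀ i, v (algebraMap E L (g.coeff i)) ≤ 1) → (∃ i, v (algebraMap E L (g.coeff i)) = 1) →
    v (aeval x g) < 1 → ∃ f : E[X], f.Monic ∧ f.natDegree ≤ g.natDegree ∧
      (∀ i, v (algebraMap E L (f.coeff i)) ≤ 1) ∧ v (aeval x f) < 1 := by
  intro n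
  induction n with
  | zero =>
    rintro g hg - ⟨i, hi⟩ -
    have : g = 0 := by simpa using hg
    simp [this] at hi
  | succ n ih =>
    rintro g hg h1 ⟨i, hi⟩ h2
    have hg0 : g ≠ 0 := by rintro rfl; simp at hi
    by_cases hl : v (algebraMap E L g.leadingCoeff) = 1
    · refine ⟨C g.leadingCoeff⁻¹ * g, ?_, ?_, ?_, ?_⟩
      · rw [Monic, leadingCoeff_mul, leadingCoeff_C, inv_mul_cancel₀ (by simpa using hg0)]
      · exact natDegree_C_mul_le _ _
      · intro i
        rw [coeff_C_mul, map_mul, map_mul, map_inv₀, map_inv₀, hl]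
        simpa using h1 i
      · rw [map_mul, map_mul, aeval_C, map_inv₀, map_inv₀, hl]
        simpa using h2
    · have hl' : v (algebraMap E L g.leadingCoeff) < 1 := lt_of_le_of_ne (h1 _) hl
      obtain ⟨f, hf1, hf2, hf3, hf4⟩ := ih g.eraseLead
        (by have := eraseLead_support_card_lt hg0; omega) (fun j => by
          rw [eraseLead_coeff]
          split_ifs
          · simp
          · exact h1 j) ⟨i, by
            rw [eraseLead_coeff, if_neg]
            · exact hi
            · rintro rfl; exact hl hi⟩ (by
            have : aeval x g.eraseLead = aeval x g - algebraMap E L g.leadingCoeff * x ^ g.natDegree := by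
              have := congrArg (aeval x) (eraseLead_add_C_mul_X_pow g)
              rw [map_add, map_mul, aeval_C, map_pow, aeval_X] at this
              rw [← this]; ring
            rw [this]
            refine v.map_sub_lt h2 ?_
            rw [map_mul, map_pow]
            exact lt_of_le_of_lt (mul_le_of_le_one_right' (pow_le_one' hx _)) hl')
      exact ⟨f, hf1, hf2.trans (eraseLead_natDegree_le_aux), hf3, hf4⟩

theorem exists_max_coeff (g : E[X]) (hg : g ≠ 0) : ∃ i, g.coeff i ≠ 0 ∧
    ∀ j, v (algebraMap E L (g.coeff j)) ≤ v (algebraMap E L (g.coeff i)) := by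
  obtain ⟨k, hk, h⟩ := g.support.exists_max_image (fun i => v (algebraMap E L (g.coeff i)))
    (by simpa using hg)
  refine ⟨k, by simpa using hk, fun j => ?_⟩
  by_cases hj : j ∈ g.support
  · exact h j hj
  · rw [notMem_support_iff.1 hj]; simp

/-- normalise -/
theorem exists_normalise (g : E[X]) (hg : g ≠ 0) : ∃ c : E, c ≠ 0 ∧
    (∀ j, v (algebraMap E L ((C c⁻¹ * g).coeff j)) ≤ 1) ∧
    (∃ j, v (algebraMap E L ((C c⁻¹ * g).coeff j)) = 1) ∧
    (∀ j, v (algebraMap E L (g.coeff j)) ≤ v (algebraMap E L c)) := by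
  obtain ⟨i, hi, h⟩ := exists_max_coeff v g hg
  have hv : v (algebraMap E L (g.coeff i)) ≠ 0 := by simpa using hi
  refine ⟨g.coeff i, hi, fun j => ?_, ⟨i, ?_⟩, h⟩
  · rw [coeff_C_mul, map_mul, map_mul, map_inv₀, map_inv₀]
    rw [inv_mul_le_iff₀ (by simpa [zero_lt_iff] using hi), mul_one]
    exact h j
  · rw [coeff_C_mul, inv_mul_cancel₀ hi]; simp

theorem v_aeval_le (x : L) (hx : v x ≤ 1) (g : E[X])
    (h1 : ∀ i, v (algebraMap E L (g.coeff i)) ≤ 1) : v (aeval x g) ≤ 1 := by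
  rw [← eval_map_algebraMap]
  exact v_eval_le v (fun i => by rw [coeff_map]; exact h1 i) hx

theorem v_aeval_sub_lt (x y : L) (hx : v x ≤ 1) (hxy : v (y - x) < 1) (g : E[X])
    (h1 : ∀ i, v (algebraMap E L (g.coeff i)) ≤ 1) : v (aeval y g - aeval x g) < 1 := by
  have hy : v y ≤ 1 := by
    have : y = (y - x) + x := by ring
    rw [this]; exact v.map_add_le hxy.le hx
  rw [aeval_eq_sum_range, aeval_eq_sum_range, ← Finset.sum_sub_distrib]
  refine v.map_sum_lt one_ne_zero fun i _ => ?_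
  rw [← smul_sub, Algebra.smul_def, map_mul, ← (Commute.all y x).geom_sum₂_mul, map_mul]
  refine lt_of_le_of_lt (mul_le_of_le_one_left' (h1 i)) ?_
  refine lt_of_le_of_lt (mul_le_of_le_one_left' ?_) hxy
  refine v.map_sum_le fun j _ => ?_
  rw [map_mul, map_pow, map_pow]
  exact mul_le_one' (pow_le_one' hy _) (pow_le_one' hx _)

theorem res_step [Algebra.IsAlgebraic E L] (hens : HenselianLocalRing v.valuationSubring)
    (hn : ∀ n : ℕ, n ≠ 0 → v (n : L) = 1) {A : Type*} [CommRing A] [Algebra A L]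
    (hU : ∀ c : E, v (algebraMap E L c) ≤ 1 → IsIntegral A (algebraMap E L c))
    (x : L) (hx : v x ≤ 1) (hxE : ∀ c : E, ¬ v (x - algebraMap E L c) < 1) :
    ∃ a : L, a ∉ Set.range (algebraMap E L) ∧ ∀ y ∈ E⟮a⟯, v y ≤ 1 → IsIntegral A y := by
  classical
  have hex : ∃ n, ∃ f : E[X], f.Monic ∧ f.natDegree = n ∧
      (∀ i, v (algebraMap E L (f.coeff i)) ≤ 1) ∧ v (aeval x f) < 1 := by
    obtain ⟨p, hp0, hp⟩ := Algebra.IsAlgebraic.isAlgebraic (R := E) x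
    obtain ⟨c, hc, h1, h2, -⟩ := exists_normalise v p hp0
    obtain ⟨f, hf1, -, hf3, hf4⟩ := trunc v x hx _ _ le_rfl h1 h2 (by simp [hp])
    exact ⟨_, f, hf1, rfl, hf3, hf4⟩
  obtain ⟨f, hfm, hfn, hfc, hfx⟩ := Nat.find_spec hex
  have hmin : ∀ g : E[X], g.natDegree < f.natDegree →
      (∀ i, v (algebraMap E L (g.coeff i)) ≤ 1) → (∃ i, v (algebraMap E L (g.coeff i)) = 1) →
      v (aeval x g) = 1 := by
    intro g hg h1 h2
    refine le_antisymm (v_aeval_le v x hx g h1) ?_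
    by_contra! h3
    obtain ⟨q, hq1, hq2, hq3, hq4⟩ := trunc v x hx _ g le_rfl h1 h2 h3
    exact Nat.find_min hex (by rw [← hfn]; exact lt_of_le_of_lt hq2 hg) ⟨q, hq1, rfl, hq3, hq4⟩
  have hn0 : f.natDegree ≠ 0 := by
    intro h
    rw [Monic.natDegree_eq_zero hfm] at h
    simp [h] at hfx
  have hd : v (aeval x (derivative f)) = 1 := by
    refine hmin _ (natDegree_derivative_lt hn0) (fun i => ?_) ⟨f.natDegree - 1, ?_⟩
    · rw [coeff_derivative, map_mul, map_mul]
      refine mul_le_one' (hfc _) ?_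
      have := hn (i + 1) (by omega)
      simp only [map_add, map_natCast, map_one]
      exact_mod_cast this.le
    · rw [coeff_derivative, Nat.sub_add_cancel (by omega), hfm.coeff_natDegree, one_mul]
      have := hn (f.natDegree) (by omega)
      have e : ((f.natDegree - 1 : ℕ) : E) + 1 = (f.natDegree : E) := by
        have : f.natDegree = (f.natDegree - 1) + 1 := by omega
        conv_rhs => rw [this]
        push_cast; rfl
      rw [e, map_natCast]
      exact this
  obtain ⟨a, ha, hax⟩ := hensel_apply v hens (f.map (algebraMap E L)) (hfm.map _)
    (fun i => by rw [coeff_map]; exact hfc i) x hx (by rwa [eval_map_algebraMap])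
    (by rwa [derivative_map, eval_map_algebraMap])
  rw [eval_map_algebraMap] at ha
  have hva : v a ≤ 1 := by
    have : a = (a - x) + x := by ring
    rw [this]; exact v.map_add_le hax.le hx
  refine ⟨a, ?_, fun y hy hvy => ?_⟩
  · rintro ⟨c, rfl⟩
    apply hxE c
    rwa [Valuation.map_sub_swap]
  obtain ⟨g, hg, rfl⟩ := mem_adjoin_poly a f hfm ha y hy
  have haint : IsIntegral A a := by
    have : IsIntegral (integralClosure A L) a := by
      have hl : f.map (algebraMap E L) ∈ Polynomial.lifts (algebraMap (integralClosure A L) L) := by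
        rw [lifts_iff_coeff_lifts]
        intro n
        exact ⟨⟨(f.map (algebraMap E L)).coeff n, by rw [coeff_map]; exact hU _ (hfc n)⟩, rfl⟩
      obtain ⟨q, hqf, -, hqm⟩ := lifts_and_natDegree_eq_and_monic hl (hfm.map _)
      refine ⟨q, hqm, ?_⟩
      rw [← eval_map, hqf, eval_map_algebraMap, ha]
    exact isIntegral_trans _ this
  by_cases hg0 : g = 0
  · simp [hg0, isIntegral_zero]
  obtain ⟨c, hc, h1, h2, h3⟩ := exists_normalise v g hg0
  have h4 := hmin _ (lt_of_le_of_lt (natDegree_C_mul_le _ _) hg) h1 h2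
  have h5 : v (aeval a (C c⁻¹ * g)) = 1 := by
    have h6 := v_aeval_sub_lt v x a hx hax _ h1
    have := v.map_add_eq_of_lt_left (y := aeval a (C c⁻¹ * g) - aeval x (C c⁻¹ * g))
      (x := aeval x (C c⁻¹ * g)) (by rwa [h4])
    rw [h4] at this
    rw [← this]; congr 1; ring
  have h6 : v (aeval a g) = v (algebraMap E L c) := by
    rw [map_mul, map_mul, aeval_C, map_inv₀, map_inv₀] at h5
    have hvc : v (algebraMap E L c) ≠ 0 := by simpa using hc
    rwa [inv_mul_eq_one₀ hvc, eq_comm] at h5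
  rw [aeval_eq_sum_range]
  refine IsIntegral.sum _ fun i _ => ?_
  rw [Algebra.smul_def]
  refine (hU _ ?_).mul (haint.pow _)
  rw [h6] at hvy
  exact (h3 i).trans hvy

theorem val_step [Algebra.IsAlgebraic E L] (hens : HenselianLocalRing v.valuationSubring)
    (hn : ∀ n : ℕ, n ≠ 0 → v (n : L) = 1) {A : Type*} [CommRing A] [Algebra A L]
    (hU : ∀ c : E, v (algebraMap E L c) ≤ 1 → IsIntegral A (algebraMap E L c))
    (hres : ∀ x, v x ≤ 1 → ∃ c : E, v (x - algebraMap E L c) < 1)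
    (x : L) (hx : x ≠ 0) (hxE : ∀ c : E, v x ≠ v (algebraMap E L c)) :
    ∃ a : L, a ∉ Set.range (algebraMap E L) ∧ ∀ y ∈ E⟮a⟯, v y ≤ 1 → IsIntegral A y := by
  classical
  have hex := exists_pow_eq (E := E) v x hx
  obtain ⟨hn0, c, hc, hxc⟩ := Nat.find_spec hex
  have hmin := fun m h => Nat.find_min (m := m) hex h
  generalize Nat.find hex = n at *
  have hcL : algebraMap E L c ≠ 0 := by simpa using hc
  have hvc : v (algebraMap E L c) ≠ 0 := by simpa using hc
  set u := x ^ n / algebraMap E L c with hu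
  have hvu : v u = 1 := by rw [hu, map_div₀, map_pow, hxc, div_self hvc]
  obtain ⟨d, hd⟩ := hres u hvu.le
  have hvd : v (algebraMap E L d) = 1 := by
    have := v.map_sub_eq_of_lt_left (x := u) (y := u - algebraMap E L d) (by rwa [hvu])
    rwa [sub_sub_cancel, hvu] at this
  have hd0 : algebraMap E L d ≠ 0 := by
    intro h; rw [h, map_zero] at hvd; exact zero_ne_one hvd
  obtain ⟨t, ht, ht1⟩ := hensel_apply v hens (X ^ n - C (u / algebraMap E L d))
    (monic_X_pow_sub_C _ hn0) (fun i => by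
      rw [coeff_sub, coeff_X_pow, coeff_C]
      refine (v.map_sub_le (g := 1) ?_ ?_)
      · split_ifs <;> simp
      · split_ifs
        · rw [map_div₀, hvu, hvd, div_one]
        · simp) 1 (by simp) (by
        have : eval 1 (X ^ n - C (u / algebraMap E L d)) =
          - ((u - algebraMap E L d) / algebraMap E L d) := by
          simp; field_simp; ring
        rw [this, Valuation.map_neg, map_div₀, hvd, div_one]; exact hd) (by
        rw [derivative_sub, derivative_C, derivative_X_pow]; simp [hn n hn0])
  have ht' : t ^ n = u / algebraMap E L d := by
    simpa [sub_eq_zero] using ht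
  have hvt : v t = 1 := by
    have h1 : v t ^ n = 1 := by rw [← map_pow, ht', map_div₀, hvu, hvd, div_one]
    exact (pow_eq_one_iff_left hn0).1 h1
  have ht0 : t ≠ 0 := by
    intro h; rw [h, map_zero] at hvt; exact zero_ne_one hvt
  set y := x / t with hy
  have hvy : v y = v x := by rw [hy, map_div₀, hvt, div_one]
  have hu0 : u ≠ 0 := by intro h; rw [h, map_zero] at hvu; exact zero_ne_one hvu
  have hyn : y ^ n = algebraMap E L (c * d) := by
    rw [hy, div_pow, ht', map_mul]
    have : x ^ n = u * algebraMap E L c := by rw [hu]; field_simp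
    rw [this]; field_simp
  refine ⟨y, ?_, fun z hz hvz => ?_⟩
  · rintro ⟨b, hb⟩
    exact hxE b (by rw [hb, hvy])
  obtain ⟨g, hg, rfl⟩ := mem_adjoin_poly y (X ^ n - C (c * d)) (monic_X_pow_sub_C _ hn0)
    (by simp [hyn]) z hz
  rw [natDegree_X_pow_sub_C] at hg
  rw [aeval_eq_sum_range] at hvz ⊢
  have hvx : v x ≠ 0 := by simpa using hx
  have key := v_sum_distinct v (Finset.range (g.natDegree + 1)) (fun i => g.coeff i • y ^ i) (by
    have main : ∀ i j : ℕ, i < j → j < n → g.coeff i ≠ 0 → g.coeff j ≠ 0 →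
        v (g.coeff i • y ^ i) = v (g.coeff j • y ^ j) → False := by
      intro i j hij hj h1 h2 e
      refine hmin (j - i) (by omega) ⟨by omega, (g.coeff i / g.coeff j), (div_ne_zero h1 h2), ?_⟩
      obtain ⟨k, rfl⟩ := Nat.exists_eq_add_of_lt hij
      have hvj : v (algebraMap E L (g.coeff (i + k + 1))) ≠ 0 := by simpa using h2
      simp only [Algebra.smul_def, map_mul, map_pow, hvy] at e
      rw [map_div₀, map_div₀, eq_div_iff hvj]
      have : i + k + 1 - i = k + 1 := by omega
      rw [this]
      apply mul_right_cancel₀ (pow_ne_zero i hvx)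
      rw [e, show i + k + 1 = (k + 1) + i by omega, pow_add (v x) (k + 1) i, ← mul_assoc,
        mul_comm (v x ^ (k + 1))]
    intro i hi j hj h0 e
    rw [Finset.mem_range] at hi hj
    have h1 : g.coeff i ≠ 0 := by intro h; simp [h] at h0
    have h2 : g.coeff j ≠ 0 := by
      intro h
      simp only [h, zero_smul, map_zero, map_eq_zero] at e
      exact h0 e
    rcases lt_trichotomy i j with h | h | h
    · exact (main i j h (by omega) h1 h2 e).elim
    · exact h
    · exact (main j i h (by omega) h2 h1 e.symm).elim)
  refine IsIntegral.sum _ fun i hi => ?_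
  have h1 := (key i hi).trans hvz
  refine IsIntegral.of_pow (n := n) (by omega) ?_
  have e : (g.coeff i • y ^ i) ^ n = algebraMap E L (g.coeff i ^ n * (c * d) ^ i) := by
    rw [Algebra.smul_def, mul_pow, ← pow_mul, mul_comm i n, pow_mul, hyn]; simp
  rw [e]
  refine hU _ ?_
  rw [← e, map_pow]
  exact pow_le_one' h1 n

end steps

end part5

section part6
open IsLocalRing Polynomial IntermediateField
open scoped Pointwise

section zorn
variable {K L Γ : Type*} [Field K] [Field L] [Algebra K L] [LinearOrderedCommGroupWithZero Γ]
  (v : Valuation L Γ)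

/-- Elements of `E` of value at most one are integral over the valuation ring of `K`. -/
def UProp (E : IntermediateField K L) : Prop :=
  ∀ x ∈ E, v x ≤ 1 → IsIntegral ↥(v.comap (algebraMap K L)).valuationSubring x

theorem exists_L0 [Algebra.IsAlgebraic K L] (hens : HenselianLocalRing v.valuationSubring)
    (hn : ∀ n : ℕ, n ≠ 0 → v (n : L) = 1) :
    ∃ E : IntermediateField K L, UProp v E ∧ (∀ x, v x ≤ 1 → ∃ c ∈ E, v (x - c) < 1) ∧
      (∀ x, x ≠ 0 → ∃ c ∈ E, v x = v c) := by
  obtain ⟨E, hE⟩ := zorn_le₀ {E : IntermediateField K L | UProp v E} (by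
    intro c hc hchain
    by_cases hne : c.Nonempty
    · refine ⟨sSup c, ?_, fun z hz => le_sSup hz⟩
      intro x hx
      have hd : DirectedOn (· ≤ ·) c := hchain.directedOn
      have : Nonempty c := hne.to_subtype
      rw [sSup_eq_iSup', ← SetLike.mem_coe, IntermediateField.coe_iSup_of_directed hd.directed_val,
        Set.mem_iUnion] at hx
      obtain ⟨M, hM⟩ := hx
      exact hc M.2 x hM
    · refine ⟨⊥, ?_, fun z hz => (hne ⟨z, hz⟩).elim⟩
      intro x hx hvx
      rw [IntermediateField.mem_bot] at hx
      obtain ⟨y, rfl⟩ := hx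
      exact isIntegral_algebraMap (R := ↥(v.comap (algebraMap K L)).valuationSubring)
        (x := ⟨y, hvx⟩))
  have hUE : UProp v E := hE.prop
  have hU : ∀ c : E, v (algebraMap E L c) ≤ 1 →
      IsIntegral ↥(v.comap (algebraMap K L)).valuationSubring (algebraMap E L c) :=
    fun c hc => hUE c.1 c.2 hc
  have hmax : ∀ a : L, (∀ y ∈ E⟮a⟯, v y ≤ 1 →
      IsIntegral ↥(v.comap (algebraMap K L)).valuationSubring y) → 
      a ∈ Set.range (algebraMap E L) := by
    intro a ha
    have h1 : UProp v (E⟮a⟯.restrictScalars K) := fun y hy => ha y hy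
    have h2 : E⟮a⟯.restrictScalars K ≤ E := hE.le_of_ge h1 (fun y hy =>
      E⟮a⟯.algebraMap_mem ⟨y, hy⟩)
    exact ⟨⟨a, h2 (IntermediateField.mem_adjoin_simple_self E a)⟩, rfl⟩
  have : Algebra.IsAlgebraic E L := Algebra.IsAlgebraic.tower_top (K := K) E
  have hres : ∀ x, v x ≤ 1 → ∃ c : E, v (x - algebraMap E L c) < 1 := by
    intro x hx
    by_contra! hcon
    obtain ⟨a, ha, ha'⟩ := res_step v hens hn hU x hx (fun c => not_lt.2 (hcon c))
    exact ha (hmax a ha')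
  refine ⟨E, hUE, fun x hx => ?_, fun x hx => ?_⟩
  · obtain ⟨c, hc⟩ := hres x hx
    exact ⟨c.1, c.2, hc⟩
  · by_contra! hcon
    obtain ⟨a, ha, ha'⟩ := val_step v hens hn hU hres x hx (fun c => hcon c.1 c.2)
    exact ha (hmax a ha')

theorem uniq_aux [Algebra.IsAlgebraic K L] (E : IntermediateField K L) (hU : UProp v E)
    {Γ₁ : Type*} [LinearOrderedCommGroupWithZero Γ₁] (v₁ : Valuation E Γ₁)
    (h : (v₁.comap (algebraMap K E)).IsEquiv (v.comap (algebraMap K L))) :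
    v₁.IsEquiv (v.comap (algebraMap E L)) := by
  have hK : ∀ c : K, v₁ (algebraMap K E c) ≤ 1 ↔ v (algebraMap K L c) ≤ 1 := by
    intro c
    exact Valuation.isEquiv_iff_val_le_one.1 h
  have hle : ∀ x : E, v x.1 ≤ 1 → v₁ x ≤ 1 := by
    intro x hx
    have h1 := hU x.1 x.2 hx
    have h2 : IsIntegral ↥(v.comap (algebraMap K L)).valuationSubring x :=
      (isIntegral_algebraMap_iff (B := L) (algebraMap E L).injective).1 h1
    exact val_le_one_of_isIntegral v₁ (fun a => (hK a.1).2 a.2) h2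
  rw [Valuation.isEquiv_iff_val_le_one]
  intro x
  refine ⟨fun hx => ?_, hle x⟩
  by_contra! hx1
  change 1 < v x.1 at hx1
  have hx0 : x.1 ≠ 0 := by intro h0; simp [h0] at hx1
  obtain ⟨m, hm, c, hc, hxc⟩ := exists_pow_eq (E := K) v x.1 hx0
  have hvc : 1 < v (algebraMap K L c) := by rw [← hxc]; exact one_lt_pow₀ hx1 hm
  have hvc0 : v (algebraMap K L c) ≠ 0 := by simpa using hc
  have hvx0 : v x.1 ≠ 0 := by simpa using hx0
  have h1 : v₁ (algebraMap K E c / x ^ m) ≤ 1 := by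
    apply hle
    change v (algebraMap K L c / x.1 ^ m) ≤ 1
    rw [map_div₀, map_pow, hxc, div_self hvc0]
  have hx0' : x ≠ 0 := fun h => hx0 (by rw [h]; rfl)
  have h2 : v₁ (algebraMap K E c) ≤ 1 := by
    have e : algebraMap K E c = algebraMap K E c / x ^ m * x ^ m := by
      field_simp
    rw [e, map_mul, map_pow]
    exact mul_le_one' h1 (pow_le_one' hx m)
  exact absurd ((hK c).1 h2) (not_le.2 hvc)

end zorn

end part6

section part7
open IsLocalRing Polynomial IntermediateField
open scoped Pointwise

theorem exists_henW {F N Γ : Type*} [Field F] [Field N] [Algebra F N] [IsGalois F N]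
    [LinearOrderedCommGroupWithZero Γ] (v : Valuation F Γ)
    (hens : HenselianLocalRing v.valuationSubring) :
    ∃ W : ValuationSubring N, (∀ x, x ∈ W ↔ IsIntegral ↥v.valuationSubring x) ∧
      ∀ a : F, algebraMap F N a ∈ W ↔ v a ≤ 1 := by
  let W : ValuationSubring N :=
    { (integralClosure ↥v.valuationSubring N).toSubring with
      mem_or_inv_mem' := fun x => hens_val (F := F) x }
  refine ⟨W, fun x => Iff.rfl, fun a => ?_⟩
  change IsIntegral ↥v.valuationSubring (algebraMap F N a) ↔ _
  rw [isIntegral_algebraMap_iff (algebraMap F N).injective]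
  constructor
  · intro h
    exact val_le_one_of_isIntegral v (fun a => a.2) h
  · intro h
    exact isIntegral_algebraMap (R := ↥v.valuationSubring) (x := ⟨a, h⟩)

theorem integral_of_le_one {F L Γ : Type*} (N : Type*) [Field F] [Field L] [Field N] [Algebra F N]
    [Algebra F L] [Algebra L N] [IsScalarTower F L N] [IsGalois F N] [IsGalois L N]
    [LinearOrderedCommGroupWithZero Γ] (v : Valuation L Γ)
    (hens : HenselianLocalRing v.valuationSubring)
    (hensF : HenselianLocalRing (v.comap (algebraMap F L)).valuationSubring) (x : L) (hx : v x ≤ 1) :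
    IsIntegral ↥(v.comap (algebraMap F L)).valuationSubring x := by
  obtain ⟨W₁, hW₁, hW₁'⟩ := exists_henW (N := N) (v.comap (algebraMap F L)) hensF
  obtain ⟨W₂, -, hW₂⟩ := exists_henW (N := N) v hens
  obtain ⟨ρ, hρ⟩ := exists_conj (v.comap (algebraMap F L)).valuationSubring W₁ W₂ (fun a => hW₁' a)
    (fun a => by rw [IsScalarTower.algebraMap_apply F L N, hW₂]; rfl)
  have h1 : ρ⁻¹ (algebraMap L N x) ∈ W₁ := by
    rw [hρ]
    have : ρ (ρ⁻¹ (algebraMap L N x)) = algebraMap L N x := by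
      rw [← AlgEquiv.mul_apply]; simp
    rw [this, hW₂]; exact hx
  rw [hW₁] at h1
  have h2 : IsIntegral ↥(v.comap (algebraMap F L)).valuationSubring (algebraMap L N x) := by
    have := h1.map (ρ.toAlgHom.restrictScalars ↥(v.comap (algebraMap F L)).valuationSubring)
    have e : (ρ.toAlgHom.restrictScalars ↥(v.comap (algebraMap F L)).valuationSubring)
      (ρ⁻¹ (algebraMap L N x)) = algebraMap L N x := by
      change ρ (ρ⁻¹ (algebraMap L N x)) = algebraMap L N x
      rw [← AlgEquiv.mul_apply]; simp
    rwa [e] at this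
  have : IsScalarTower ↥(v.comap (algebraMap F L)).valuationSubring L N :=
    IsScalarTower.to₁₃₄ _ F L N
  exact (isIntegral_algebraMap_iff (algebraMap L N).injective).1 h2

theorem trace_top {F L Γ : Type*} [Field F] [Field L] [Algebra F L] [Algebra.IsAlgebraic F L]
    [LinearOrderedCommGroupWithZero Γ] (v : Valuation L Γ)
    (hn : ∀ n : ℕ, n ≠ 0 → v (n : L) = 1) (M : IntermediateField F L)
    (hres : ∀ x, v x ≤ 1 → ∃ c ∈ M, v (x - c) < 1)
    (hval : ∀ x, x ≠ 0 → ∃ c ∈ M, v x = v c)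
    (hint : ∀ x, v x ≤ 1 → IsIntegral ↥(v.comap (algebraMap F L)).valuationSubring x) :
    M = ⊤ := by
  by_contra hM
  obtain ⟨a, ha⟩ : ∃ a, a ∉ M := by
    by_contra! h
    exact hM (eq_top_iff.2 fun x _ => h x)
  have : Algebra.IsAlgebraic M L := Algebra.IsAlgebraic.tower_top (K := F) M
  let E := M⟮a⟯
  have : FiniteDimensional M E := IntermediateField.adjoin.finiteDimensional
    (Algebra.IsAlgebraic.isAlgebraic a).isIntegral
  let T := Algebra.trace M E
  set n := Module.finrank M E with hnE
  have hn0 : n ≠ 0 := Module.finrank_pos.ne'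
  have hnM : (n : M) ≠ 0 := by
    intro h
    have := hn n hn0
    have h' : (n : L) = 0 := by
      have := congrArg (algebraMap M L) h
      simpa using this
    rw [h', map_zero] at this
    exact zero_ne_one this
  have hTM : ∀ c : M, T (algebraMap M E c) = n * c := by
    intro c
    simp [T, Algebra.trace_algebraMap, hnE]
  let a' : E := ⟨a, IntermediateField.mem_adjoin_simple_self M a⟩
  let b : E := a' - algebraMap M E (T a' / n)
  have hTb : T b = 0 := by
    simp only [b, map_sub, hTM]
    field_simp
    simp
  have hb0 : b.1 ≠ 0 := by
    intro h
    have h1 : a = (T a' / n).1 := sub_eq_zero.1 h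
    rw [h1] at ha
    exact ha (T a' / n).2
  -- approximate b by an element of M
  obtain ⟨c₁, hc₁, hbc₁⟩ := hval b.1 hb0
  have hc₁0 : c₁ ≠ 0 := by
    rintro rfl; simp [hb0] at hbc₁; 
  have hvb0 : v b.1 ≠ 0 := by simpa using hb0
  have hvc₁ : v c₁ ≠ 0 := by simpa using hc₁0
  obtain ⟨c₂, hc₂, hbc₂⟩ := hres (b.1 / c₁) (by rw [map_div₀, hbc₁, div_self hvc₁])
  have hvc₂ : v c₂ = 1 := by
    have h1 : v (b.1 / c₁) = 1 := by rw [map_div₀, hbc₁, div_self hvc₁]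
    have := v.map_sub_eq_of_lt_left (x := b.1 / c₁) (y := b.1 / c₁ - c₂) (by rwa [h1])
    rwa [sub_sub_cancel, h1] at this
  have hc₂0 : c₂ ≠ 0 := by rintro rfl; simp at hvc₂
  let c : M := ⟨c₁ * c₂, M.mul_mem hc₁ hc₂⟩
  have hc0 : c ≠ 0 := fun h => (mul_ne_zero hc₁0 hc₂0) (congrArg Subtype.val h)
  -- y = b / c - 1
  let y : E := c⁻¹ • b - 1
  have hvy : v y.1 < 1 := by
    have : y.1 = (b.1 / c₁ - c₂) / c₂ := by
      change (c₁ * c₂)⁻¹ * b.1 - 1 = _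
      field_simp
    rw [this, map_div₀, hvc₂, div_one]
    exact hbc₂
  have hTy : T y = - n := by
    have h1 : T (1 : E) = n := by
      have := hTM 1
      rwa [map_one, mul_one] at this
    simp only [y, map_sub, map_smul, hTb, h1]
    simp
  have hy0 : y.1 ≠ 0 := by
    intro h
    have : y = 0 := Subtype.ext h
    rw [this, map_zero] at hTy
    exact hnM (by simpa using hTy.symm)
  obtain ⟨d, hd, hyd⟩ := hval y.1 hy0
  have hd0 : d ≠ 0 := by rintro rfl; simp [hy0] at hyd
  let d' : M := ⟨d, hd⟩
  have hd'0 : d' ≠ 0 := fun h => hd0 (congrArg Subtype.val h)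
  let u : E := d'⁻¹ • y
  have hvu : v u.1 ≤ 1 := by
    change v (d⁻¹ * y.1) ≤ 1
    rw [map_mul, map_inv₀, hyd, inv_mul_cancel₀ (by simpa using hd0)]
  have hu : IsIntegral ↥(v.comap (algebraMap F L)).valuationSubring u := by
    have hh := hint _ hvu
    have : IsScalarTower ↥(v.comap (algebraMap F L)).valuationSubring E L :=
      IsScalarTower.of_algebraMap_eq fun _ => rfl
    exact (isIntegral_algebraMap_iff (B := L) (algebraMap E L).injective).1 hh
  have hTu := Algebra.isIntegral_trace (L := M) hu
  have hTu1 : v (Algebra.trace M E u).1 ≤ 1 :=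
    val_le_one_of_isIntegral (A := ↥(v.comap (algebraMap F L)).valuationSubring)
      (v.comap (algebraMap M L)) (fun a => a.2) hTu
  have hyu : y = d' • u := by
    simp only [u, smul_smul, mul_inv_cancel₀ hd'0, one_smul]
  have h5 : (- n : M) = d' * T u := by
    rw [← hTy, hyu, map_smul, smul_eq_mul]
  have h6 : v (-(n : L)) = v d * v (T u).1 := by
    have := congrArg (fun z : M => v z.1) h5
    simpa using this
  rw [Valuation.map_neg, hn n hn0, ← hyd] at h6
  have : v y.1 * v (T u).1 < 1 := lt_of_le_of_lt (mul_le_of_le_one_right' hTu1) hvy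
  rw [← h6] at this
  exact lt_irrefl _ this

end part7

section part8
open IsLocalRing Polynomial IntermediateField
open scoped Pointwise

theorem hensel_unique {M Γ : Type*} [Field M] [LinearOrderedCommGroupWithZero Γ] (v : Valuation M Γ)
    (f : M[X]) (hf : ∀ i, v (f.coeff i) ≤ 1) (a b : M) (ha : v a ≤ 1) (hb : v b ≤ 1)
    (hfa : f.eval a = 0) (hfb : f.eval b = 0) (hab : v (b - a) < 1)
    (h2 : v (f.derivative.eval a) = 1) : b = a := by
  have hl : f ∈ Polynomial.lifts v.valuationSubring.subtype := by
    rw [lifts_iff_coeff_lifts]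
    intro n
    exact ⟨⟨f.coeff n, hf n⟩, rfl⟩
  obtain ⟨q, hqf⟩ := (mem_lifts _).1 hl
  have e : ∀ (q : (v.valuationSubring)[X]) (b : v.valuationSubring),
      (q.map v.valuationSubring.subtype).eval b.1 = (q.eval b).1 := by
    intro q b
    exact eval_map_apply (f := v.valuationSubring.subtype) (p := q) (x := b)
  let a' : v.valuationSubring := ⟨a, ha⟩
  let b' : v.valuationSubring := ⟨b, hb⟩
  have hqa : q.eval a' = 0 := Subtype.ext (by rw [← e, hqf]; exact hfa)
  have hqb : q.eval b' = 0 := Subtype.ext (by rw [← e, hqf]; exact hfb)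
  obtain ⟨k, hk⟩ := q.binomExpansion a' (b' - a')
  rw [add_sub_cancel, hqa, hqb, zero_add] at hk
  by_contra hne
  have h3 : (b' - a') * (q.derivative.eval a' + k * (b' - a')) = 0 := by
    rw [hk]; ring
  rcases mul_eq_zero.1 h3 with h4 | h4
  · exact hne (sub_eq_zero.1 (congrArg Subtype.val h4))
  · have h5 : f.derivative.eval a = - (k.1 * (b - a)) := by
      have h6 : (q.derivative.eval a').1 = f.derivative.eval a := by
        rw [← e, ← derivative_map, hqf]
      rw [← h6]
      exact eq_neg_of_add_eq_zero_left (congrArg Subtype.val h4)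
    rw [h5, Valuation.map_neg, map_mul] at h2
    have h7 : v k.1 * v (b - a) < 1 := lt_of_le_of_lt (mul_le_of_le_one_left' k.2) hab
    exact h7.ne h2

theorem lt_one_iff_inv {M Γ : Type*} [Field M] [LinearOrderedCommGroupWithZero Γ]
    (v : Valuation M Γ) (x : M) : v x < 1 ↔ x = 0 ∨ ¬ v x⁻¹ ≤ 1 := by
  by_cases h : x = 0
  · simp [h]
  · rw [map_inv₀, inv_le_one₀ (by simpa [zero_lt_iff] using h)]
    simp [h]

section disj
variable {K L N Γ : Type*} [Field K] [Field L] [Field N] [Algebra K L] [Algebra L N] [Algebra K N]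
  [IsScalarTower K L N] [LinearOrderedCommGroupWithZero Γ] (v : Valuation L Γ)
  (W : ValuationSubring N)

variable (K L) in
/-- The decomposition field of `W`, inside `L`. -/
def Zf : IntermediateField K L where
  carrier := {x | ∀ σ : N ≃ₐ[K] N, (∀ y, y ∈ W ↔ σ y ∈ W) →
    σ (algebraMap L N x) = algebraMap L N x}
  mul_mem' := by
    intro a b ha hb σ hσ
    rw [map_mul, map_mul, ha σ hσ, hb σ hσ]
  add_mem' := by
    intro a b ha hb σ hσ
    rw [map_add, map_add, ha σ hσ, hb σ hσ]
  algebraMap_mem' := by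
    intro r σ hσ
    rw [← IsScalarTower.algebraMap_apply K L N, AlgEquiv.commutes]
  inv_mem' := by
    intro a ha σ hσ
    rw [map_inv₀, map_inv₀, ha σ hσ]

theorem Zf_hens (hens : HenselianLocalRing v.valuationSubring)
    (hW : ∀ a : L, algebraMap L N a ∈ W ↔ v a ≤ 1) :
    HenselianLocalRing ↥(v.comap (algebraMap ↥(Zf K L W) L)).valuationSubring := by
  have hw1 : ∀ a : L, W.valuation (algebraMap L N a) ≤ 1 ↔ v a ≤ 1 := by
    intro a; rw [W.valuation_le_one_iff, hW]
  have hw2 : ∀ a : L, W.valuation (algebraMap L N a) < 1 ↔ v a < 1 := by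
    intro a
    rw [lt_one_iff_inv, lt_one_iff_inv, ← map_inv₀, hw1]
    simp
  have hweq : ∀ a : L, W.valuation (algebraMap L N a) = 1 ↔ v a = 1 := by
    intro a
    rw [eq_iff_le_not_lt, eq_iff_le_not_lt, hw1, hw2]
  apply hensel_of
  intro f hfm hfc a₀ ha₀ h1 h2
  have e0 : ∀ (g : (Zf K L W)[X]) (b : Zf K L W),
      (g.map (algebraMap (Zf K L W) L)).eval (algebraMap (Zf K L W) L b)
        = algebraMap (Zf K L W) L (g.eval b) := by
    intro g b
    exact eval_map_apply (f := (algebraMap (Zf K L W) L)) (p := g) (x := b)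
  have ha₀' : v (algebraMap (Zf K L W) L a₀) ≤ 1 := ha₀
  have hd0 : v ((derivative (f.map (algebraMap (Zf K L W) L))).eval (algebraMap (Zf K L W) L a₀)) = 1 := by
    rw [derivative_map, e0]; exact h2
  obtain ⟨a, ha, haa₀⟩ := hensel_apply v hens (f.map (algebraMap (Zf K L W) L)) (hfm.map _)
    (fun i => by rw [coeff_map]; exact hfc i) (algebraMap (Zf K L W) L a₀) ha₀
    (by rw [e0]; exact h1) hd0
  set F := f.map (algebraMap (Zf K L W) L) with hF
  have hFc : ∀ i, v (F.coeff i) ≤ 1 := fun i => by rw [hF, coeff_map]; exact hfc i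
  have hva : v a ≤ 1 := by
    have : a = (a - algebraMap (Zf K L W) L a₀) + algebraMap (Zf K L W) L a₀ := by ring
    rw [this]; exact v.map_add_le haa₀.le ha₀
  have hda : v (F.derivative.eval a) = 1 := by
    have h6 := v_aeval_sub_lt (E := L) v (algebraMap (Zf K L W) L a₀) a ha₀ haa₀ F.derivative (by
      intro i
      rw [Algebra.algebraMap_self, RingHom.id_apply, coeff_derivative, map_mul]
      refine mul_le_one' (hFc _) ?_
      have : v ((i + 1 : ℕ) : L) ≤ 1 := by
        have := natCast_mem v.valuationSubring (i + 1)
        exact this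
      exact_mod_cast this)
    rw [coe_aeval_eq_eval, coe_aeval_eq_eval] at h6
    have := v.map_add_eq_of_lt_left (y := F.derivative.eval a - F.derivative.eval (algebraMap (Zf K L W) L a₀))
      (x := F.derivative.eval (algebraMap (Zf K L W) L a₀)) (by rwa [hd0])
    rwa [add_sub_cancel, hd0] at this
  have haZ : a ∈ Zf K L W := by
    intro σ hσ
    have hσ1 : ∀ y, W.valuation (σ y) ≤ 1 ↔ W.valuation y ≤ 1 := by
      intro y; rw [W.valuation_le_one_iff, W.valuation_le_one_iff, hσ y]
    have hσ2 : ∀ y, W.valuation (σ y) < 1 ↔ W.valuation y < 1 := by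
      intro y
      rw [lt_one_iff_inv, lt_one_iff_inv, ← map_inv₀, hσ1]
      simp
    have hσa₀ : σ (algebraMap L N (algebraMap (Zf K L W) L a₀)) =
      algebraMap L N (algebraMap (Zf K L W) L a₀) := a₀.2 σ hσ
    have e1 : ∀ (g : L[X]) (b : L), (g.map (algebraMap L N)).eval (algebraMap L N b)
        = algebraMap L N (g.eval b) := by
      intro g b
      exact eval_map_apply (f := algebraMap L N) (p := g) (x := b)
    refine hensel_unique W.valuation (F.map (algebraMap L N)) (fun i => ?_) _ _ ((hw1 a).2 hva)
      ((hσ1 _).2 ((hw1 a).2 hva)) ?_ ?_ ?_ ?_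
    · rw [coeff_map, hw1]; exact hFc i
    · rw [e1, ha, map_zero]
    · have hFσ : (F.map (algebraMap L N)).map (σ : N →+* N) = F.map (algebraMap L N) := by
        ext i
        rw [coeff_map, coeff_map, hF, coeff_map]
        exact (f.coeff i).2 σ hσ
      have h7 : ((F.map (algebraMap L N)).map (σ : N →+* N)).eval (σ (algebraMap L N a)) =
          σ ((F.map (algebraMap L N)).eval (algebraMap L N a)) :=
        eval_map_apply (f := (σ : N →+* N)) (p := F.map (algebraMap L N)) (x := algebraMap L N a)
      rw [hFσ, e1, ha, map_zero, map_zero] at h7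
      exact h7
    · have h8 : W.valuation (algebraMap L N (a - algebraMap (Zf K L W) L a₀)) < 1 := (hw2 _).2 haa₀
      have h9 := (hσ2 _).2 h8
      have := W.valuation.map_sub_lt h9 h8
      rwa [map_sub (algebraMap L N), map_sub σ, hσa₀, sub_sub_sub_cancel_right] at this
    · rw [derivative_map, e1, hweq]; exact hda
  exact ⟨⟨a, haZ⟩, by
    have := e0 f ⟨a, haZ⟩
    rw [← hF] at this
    exact Subtype.ext (this.symm.trans ha), haa₀⟩

theorem exists_dec [Algebra.IsAlgebraic K L] (hW : ∀ a : L, algebraMap L N a ∈ W ↔ v a ≤ 1)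
    (E : IntermediateField K L) (hU : UProp v E) [IsGalois E N] (τ : N ≃ₐ[K] N) :
    ∃ σ : N ≃ₐ[K] N, (∀ y, y ∈ W ↔ σ y ∈ W) ∧
      ∀ x ∈ E, σ (algebraMap L N x) = τ (algebraMap L N x) := by
  let W₁ : ValuationSubring N := W.comap (τ : N →+* N)
  have hW₁ : ∀ x, x ∈ W₁ ↔ τ x ∈ W := fun x => ValuationSubring.mem_comap
  have heq := uniq_aux v E hU (W₁.valuation.comap (algebraMap E N)) (by
    rw [Valuation.isEquiv_iff_val_le_one]
    intro c
    change W₁.valuation (algebraMap L N (algebraMap K L c)) ≤ 1 ↔ v (algebraMap K L c) ≤ 1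
    rw [W₁.valuation_le_one_iff, hW₁, ← IsScalarTower.algebraMap_apply K L N, AlgEquiv.commutes,
      IsScalarTower.algebraMap_apply K L N, hW])
  rw [Valuation.isEquiv_iff_val_le_one] at heq
  obtain ⟨ρ, hρ⟩ := exists_conj (v.comap (algebraMap E L)).valuationSubring W W₁
    (fun a => hW a.1) (fun a => by
      rw [← W₁.valuation_le_one_iff]; exact heq)
  have : IsScalarTower K E N := IsScalarTower.of_algebraMap_eq fun x => 
    IsScalarTower.algebraMap_apply K L N x
  refine ⟨(ρ.restrictScalars K).trans τ, fun y => ?_, fun x hx => ?_⟩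
  · rw [hρ, hW₁]; rfl
  · change τ (ρ (algebraMap L N x)) = _
    congr 1
    exact ρ.commutes ⟨x, hx⟩

theorem disj_main [Algebra.IsAlgebraic K L] [IsAlgClosed N] [IsGalois K N]
    (hW : ∀ a : L, algebraMap L N a ∈ W ↔ v a ≤ 1)
    (E : IntermediateField K L) (hU : UProp v E) [IsGalois E N]
    (Kh : IntermediateField K L) (hKh : Kh ≤ Zf K L W) : E.LinearDisjoint ↥Kh := by
  classical
  have : Algebra.IsAlgebraic K N := inferInstance
  let b := Module.Free.chooseBasis K Kh
  refine IntermediateField.LinearDisjoint.of_basis_right b ?_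
  rw [linearIndependent_iff']
  intro s g hg i₀ hi₀
  let S : Set L := (s.image (fun i => (g i : L)) : Finset L)
  have hSE : adjoin K S ≤ E := by
    rw [IntermediateField.adjoin_le_iff]
    intro x hx
    obtain ⟨i, -, rfl⟩ := Finset.mem_image.1 (Finset.mem_coe.1 hx)
    exact (g i).2
  let F := adjoin K S
  have : FiniteDimensional K F := finiteDimensional_adjoin
    (fun x _ => (Algebra.IsAlgebraic.isAlgebraic x).isIntegral)
  have : IsScalarTower K F N := IsScalarTower.of_algebraMap_eq fun x => 
    IsScalarTower.algebraMap_apply K L N x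
  have : Algebra.IsSeparable K F := Algebra.isSeparable_tower_bot_of_isSeparable K F N
  have hgF : ∀ i ∈ s, (g i : L) ∈ F := fun i hi =>
    IntermediateField.subset_adjoin K S (Finset.mem_coe.2 (Finset.mem_image_of_mem _ hi))
  have key : ∀ (y : F) (σ : F →ₐ[K] N),
      ∑ i : s, σ (⟨g i, hgF i i.2⟩ * y) * algebraMap L N (b i) = 0 := by
    intro y σ
    let τ : N ≃ₐ[K] N := (Algebra.IsAlgebraic.algEquivEquivAlgHom K N).symm (σ.liftNormal N)
    have hτ : ∀ x : F, τ (algebraMap F N x) = σ x := by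
      intro x
      have h1 : (Algebra.IsAlgebraic.algEquivEquivAlgHom K N) τ = σ.liftNormal N :=
        MulEquiv.apply_symm_apply _ _
      have h2 : τ (algebraMap F N x) = σ.liftNormal N (algebraMap F N x) := by
        rw [← h1]; rfl
      rw [h2, AlgHom.liftNormal_commutes]; rfl
    obtain ⟨δ, hδ, hδτ⟩ := exists_dec v W hW E hU τ
    have h3 : ∀ x : F, σ x = δ (algebraMap L N x.1) := by
      intro x
      rw [hδτ x.1 (hSE x.2), ← hτ x]; rfl
    have h4 : ∀ i, algebraMap L N (b i) = δ (algebraMap L N (b i)) := fun i =>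
      (hKh (b i).2 δ hδ).symm
    have h5 : ∑ i : s, σ (⟨g i, hgF i i.2⟩ * y) * algebraMap L N (b i) =
        δ (algebraMap L N (y.1 * ∑ i : s, (g i).1 * (b i).1)) := by
      rw [Finset.mul_sum, map_sum, map_sum]
      refine Finset.sum_congr rfl fun i _ => ?_
      rw [h3, h4 i, ← map_mul, ← map_mul]
      congr 2
      change (g i).1 * y.1 * _ = _
      ring
    have h6 : ∑ i : s, (g i).1 * (b i).1 = 0 := by
      rw [Finset.sum_coe_sort s (fun i => (g i).1 * (b i).1), ← hg]
      rfl
    rw [h5, h6, mul_zero, map_zero, map_zero]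
  have key2 : ∀ (y : F), ∑ i : s, Algebra.trace K F (⟨g i, hgF i i.2⟩ * y) • b i = 0 := by
    intro y
    apply Subtype.ext
    apply (algebraMap L N).injective
    have h1 : ∑ σ : F →ₐ[K] N, ∑ i : s, σ (⟨g i, hgF i i.2⟩ * y) * algebraMap L N (b i) = 0 :=
      Finset.sum_eq_zero fun σ _ => key y σ
    rw [Finset.sum_comm] at h1
    simp only [ZeroMemClass.coe_zero, map_zero, AddSubmonoidClass.coe_finsetSum, map_sum]
    rw [← h1]
    refine Finset.sum_congr rfl fun i _ => ?_
    rw [← Finset.sum_mul, ← trace_eq_sum_embeddings, IntermediateField.coe_smul, Algebra.smul_def,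
      map_mul, ← IsScalarTower.algebraMap_apply K L N]
  have key3 : ∀ (y : F), Algebra.trace K F (⟨g i₀, hgF i₀ hi₀⟩ * y) = 0 := by
    intro y
    have hli := (b.linearIndependent.comp (Subtype.val : s → _) Subtype.val_injective)
    rw [Fintype.linearIndependent_iff] at hli
    exact hli _ (key2 y) ⟨i₀, hi₀⟩
  have key4 := (traceForm_nondegenerate K F).1 ⟨g i₀, hgF i₀ hi₀⟩ key3
  have key5 : (g i₀).1 = 0 := congrArg (fun x : F => x.1) key4
  exact Subtype.ext key5

end disj

end part8

open IsLocalRing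

variable {Γ₀ : Type*} [LinearOrderedCommGroupWithZero Γ₀]

/-- Let `(L,v)` be a henselian valued field of residue characteristic `0` and `K` a
subfield with `L/K` algebraic.  Let `Kh` be the henselization of `K` inside `L`
(characterized as the minimal henselian intermediate field).  Then there is an
intermediate field `L₀` such that the extension of `v|K` to `L₀` is unique (any two
valuations on `L₀` extending `v|K` are equivalent), `L₀` is linearly disjoint from
`Kh` over `K`, `L = L₀ · Kh`, and `L` is the henselization of `L₀` (the minimal
henselian intermediate field containing `L₀`). -/
theorem exists_complement_of_henselization
    {K L : Type*} [Field K] [Field L] [Algebra K L] [Algebra.IsAlgebraic K L]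
    (v : Valuation L Γ₀)
    (hhens : HenselianLocalRing ↥v.valuationSubring)
    (hchar : CharZero (ResidueField ↥v.valuationSubring))
    (Kh : IntermediateField K L)
    (hKh : HenselianLocalRing ↥(v.comap (algebraMap ↥Kh L)).valuationSubring)
    (hKhmin : ∀ M : IntermediateField K L,
      HenselianLocalRing ↥(v.comap (algebraMap ↥M L)).valuationSubring → Kh ≤ M) :
    ∃ L₀ : IntermediateField K L,
      (∀ {Γ₁ Γ₂ : Type*} [LinearOrderedCommGroupWithZero Γ₁]
          [LinearOrderedCommGroupWithZero Γ₂]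
          (v₁ : Valuation ↥L₀ Γ₁) (v₂ : Valuation ↥L₀ Γ₂),
          (v₁.comap (algebraMap K ↥L₀)).IsEquiv (v.comap (algebraMap K L)) →
          (v₂.comap (algebraMap K ↥L₀)).IsEquiv (v.comap (algebraMap K L)) →
          v₁.IsEquiv v₂) ∧
      L₀.LinearDisjoint ↥Kh ∧
      L₀ ⊔ Kh = ⊤ ∧
      (∀ M : IntermediateField K L, L₀ ≤ M →
        HenselianLocalRing ↥(v.comap (algebraMap ↥M L)).valuationSubring → M = ⊤) := by
  have hn := natCast_v v hchar
  obtain ⟨E, hU, hres, hval⟩ := exists_L0 (K := K) v hhens hn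
  have hL0 : CharZero L := charZero_of_inj_zero fun n h => by
    by_contra hn0
    have := hn n hn0
    rw [h, map_zero] at this
    exact zero_ne_one this
  have hK0 : CharZero K := (algebraMap K L).charZero_iff (algebraMap K L).injective |>.2 hL0
  let N := AlgebraicClosure L
  have gal : ∀ F : IntermediateField K L, IsGalois F N := by
    intro F
    have : Algebra.IsAlgebraic F L := Algebra.IsAlgebraic.tower_top (K := K) F
    have : Algebra.IsAlgebraic F N := Algebra.IsAlgebraic.trans F L N
    have : IsAlgClosure F N := ⟨inferInstance, inferInstance⟩
    have := IsAlgClosure.normal F N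
    have : CharZero F := (algebraMap F L).charZero_iff (algebraMap F L).injective |>.2 hL0
    exact {}
  have galK : IsGalois K N := by
    have : Algebra.IsAlgebraic K N := Algebra.IsAlgebraic.trans K L N
    have : IsAlgClosure K N := ⟨inferInstance, inferInstance⟩
    have := IsAlgClosure.normal K N
    exact {}
  have galL : IsGalois L N := by
    have := IsAlgClosure.normal L N
    exact {}
  have htop : E ⊔ Kh = ⊤ := by
    have : Algebra.IsAlgebraic Kh L := Algebra.IsAlgebraic.tower_top (K := K) Kh
    have hle : Kh ≤ E ⊔ Kh := le_sup_right
    have hE : ∀ x ∈ E, x ∈ IntermediateField.extendScalars hle := fun x hx =>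
      (IntermediateField.mem_extendScalars hle).2 ((le_sup_left : E ≤ E ⊔ Kh) hx)
    have h := trace_top v hn (IntermediateField.extendScalars hle)
      (fun x hx => by obtain ⟨c, hc, h⟩ := hres x hx; exact ⟨c, hE c hc, h⟩)
      (fun x hx => by obtain ⟨c, hc, h⟩ := hval x hx; exact ⟨c, hE c hc, h⟩)
      (fun x hx => by
        have := gal Kh
        exact integral_of_le_one N v hhens hKh x hx)
    refine eq_top_iff.2 fun x _ => ?_
    have hx : x ∈ IntermediateField.extendScalars hle := by rw [h]; trivial
    exact (IntermediateField.mem_extendScalars hle).1 hx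
  refine ⟨E, ?_, ?_, htop, ?_⟩
  · intro Γ₁ Γ₂ _ _ v₁ v₂ h₁ h₂
    exact (uniq_aux v E hU v₁ h₁).trans (uniq_aux v E hU v₂ h₂).symm
  · obtain ⟨W, -, hW⟩ := exists_henW (N := N) v hhens
    have := gal E
    exact disj_main v W hW E hU Kh (hKhmin _ (Zf_hens v W hhens hW))
  · intro M hM hMh
    rw [eq_top_iff, ← htop]
    exact sup_le hM (hKhmin M hMh)
end

section
/- Every henselian non-trivially valued field (L,v) whose residue field has characteristic 0 admits a proper subfield K that is dense in (L,v) with respect to the valuation topology; moreover K can be chosen with L/K algebraic. -/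
open IsLocalRing

/-- `K` is dense in `(L,v)`: for every `a ∈ L` and every value `v c` (`c ≠ 0`) in
the value group, there is `b ∈ K` with `v (a - b) ≤ v c`. -/
def Valuation.DenseSubfield {L : Type*} [Field L] {Γ₀ : Type*}
    [LinearOrderedCommGroupWithZero Γ₀] (v : Valuation L Γ₀) (K : Subfield L) : Prop :=
  ∀ a c : L, c ≠ 0 → ∃ b ∈ K, v (a - b) ≤ v c

open Polynomial

lemma cofinal_of_algebraic {K L Γ₀ : Type*} [Field K] [Field L] [Algebra K L]
    [LinearOrderedCommGroupWithZero Γ₀] (v : Valuation L Γ₀) [Algebra.IsAlgebraic K L]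
    (c : L) (hc : 1 ≤ v c) : ∃ m : K, v c ≤ v (algebraMap K L m) := by
  by_contra! H
  have hIntegral : IsIntegral K c := Algebra.IsIntegral.isIntegral c
  have h0 : aeval c (minpoly K c) = 0 := minpoly.aeval K c
  have hm := minpoly.monic hIntegral
  set p := minpoly K c
  have hn : 0 < p.natDegree := minpoly.natDegree_pos hIntegral
  rw [aeval_eq_sum_range, Finset.sum_range_succ, hm.coeff_natDegree, one_smul] at h0
  have h1 : v (∑ i ∈ Finset.range p.natDegree, p.coeff i • c ^ i) < v (c ^ p.natDegree) := by
    apply Valuation.map_sum_lt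
    · apply (Valuation.ne_zero_iff v).2
      apply pow_ne_zero
      rintro rfl
      simp at hc
    · intro i hi
      rw [Finset.mem_range] at hi
      have hpos : (0 : Γ₀) < v c := lt_of_lt_of_le zero_lt_one hc
      rw [Algebra.smul_def, map_mul, map_pow, map_pow]
      calc _ < v c * v c ^ i := mul_lt_mul_of_pos_right (H _) (pow_pos hpos _)
        _ = v c ^ (i + 1) := (pow_succ' _ _).symm
        _ ≤ _ := pow_le_pow_right₀ hc hi
  rw [add_eq_zero_iff_eq_neg] at h0
  rw [h0, Valuation.map_neg] at h1
  exact lt_irrefl _ h1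

lemma newton_root {L Γ₀ : Type*} [Field L]
    [LinearOrderedCommGroupWithZero Γ₀] (v : Valuation L Γ₀)
    (hhens : HenselianLocalRing ↥v.valuationSubring) (q : L[X]) 
    (δ : L) (h0 : q.coeff 0 ≠ 0) (h1 : q.coeff 1 * δ = q.coeff 0)
    (hk : ∀ k, 2 ≤ k → v (q.coeff k * δ ^ k / q.coeff 0) < 1) :
    ∃ y : L, q.IsRoot y ∧ v y = v δ := by
  set n := q.natDegree with hn
  have hO : ∀ k, ∃ e : v.valuationSubring, 2 ≤ k → (e : L) = q.coeff k * δ ^ k / q.coeff 0 := by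
    intro k
    by_cases h : 2 ≤ k
    · exact ⟨⟨_, (Valuation.mem_valuationSubring_iff _ _).2 (hk k h).le⟩, fun _ => rfl⟩
    · exact ⟨0, fun h' => absurd h' h⟩
  choose e he using hO
  have hem : ∀ k, 2 ≤ k → e k ∈ IsLocalRing.maximalIdeal v.valuationSubring := by
    intro k h
    rw [ValuationSubring.valuation_lt_one_iff, ← v.isEquiv_valuation_valuationSubring.lt_one_iff_lt_one, he k h]
    exact hk k h
  let R : v.valuationSubring[X] := ∑ k ∈ Finset.Icc 2 (n+2), C (e k) * X ^ (n + 2 - k)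
  let P : v.valuationSubring[X] := X ^ (n+2) + (X ^ (n+1) + R)
  have hRdeg : R.degree ≤ n := by
    refine (degree_sum_le _ _).trans (Finset.sup_le fun k hk => ?_)
    rw [Finset.mem_Icc] at hk
    refine (degree_C_mul_X_pow_le _ _).trans ?_
    exact_mod_cast (by omega : n + 2 - k ≤ n)
  have hmon : P.Monic := by
    apply monic_X_pow_add
    refine lt_of_le_of_lt (degree_add_le _ _) (max_lt ?_ ?_)
    · rw [degree_X_pow]; exact_mod_cast (by omega : n + 1 < n + 2)
    · exact lt_of_le_of_lt hRdeg (by exact_mod_cast (by omega : n < n + 2))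
  have hRm : ∀ x, R.eval x ∈ IsLocalRing.maximalIdeal v.valuationSubring := by
    intro x
    simp only [R, eval_finsetSum]
    refine Ideal.sum_mem _ fun k hk => ?_
    rw [Finset.mem_Icc] at hk
    rw [eval_mul, eval_C]
    exact Ideal.mul_mem_right _ _ (hem k hk.1)
  have hRm' : ∀ x, (derivative R).eval x ∈ IsLocalRing.maximalIdeal v.valuationSubring := by
    intro x
    simp only [R, derivative_sum, eval_finsetSum]
    refine Ideal.sum_mem _ fun k hk => ?_
    rw [Finset.mem_Icc] at hk
    rw [derivative_C_mul, eval_mul, eval_C]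
    exact Ideal.mul_mem_right _ _ (hem k hk.1)
  obtain ⟨z, hz, hz1⟩ := HenselianLocalRing.is_henselian P hmon (-1) (by
      simp only [P, eval_add, eval_pow, eval_X]
      have : ((-1 : v.valuationSubring) ^ (n+2) + ((-1) ^ (n+1) + R.eval (-1))) = R.eval (-1) := by ring
      rw [this]; exact hRm _) (by
      have : (derivative P).eval (-1) = (-1) ^ (n+1) + (derivative R).eval (-1) := by
        simp only [P, derivative_add, eval_add, derivative_X_pow, eval_mul, eval_C, eval_pow, eval_X]
        simp
        ring
      rw [this]
      by_contra hcon
      have h2 : (-1 : v.valuationSubring) ^ (n+1) ∈ IsLocalRing.maximalIdeal v.valuationSubring := by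
        have := Ideal.sub_mem _ ((IsLocalRing.mem_maximalIdeal _).2 hcon) (hRm' (-1))
        simpa using this
      exact (IsLocalRing.mem_maximalIdeal _).1 h2 ((isUnit_one.neg).pow _))
  have hzu : IsUnit z := by
    by_contra hcon
    have := Ideal.sub_mem _ ((IsLocalRing.mem_maximalIdeal _).2 hcon) hz1
    have h2 : (-1 : v.valuationSubring) ∈ IsLocalRing.maximalIdeal v.valuationSubring := by
      simpa using this
    exact (IsLocalRing.mem_maximalIdeal _).1 h2 (isUnit_one.neg)
  have hvz : v (z : L) = 1 := by
    rw [v.isEquiv_valuation_valuationSubring.eq_one_iff_eq_one]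
    exact (ValuationSubring.valuation_eq_one_iff _ _).1 hzu
  have hz0 : (z : L) ≠ 0 := by
    intro h; rw [h] at hvz; simp at hvz
  refine ⟨δ / z, ?_, by rw [map_div₀, hvz, div_one]⟩
  have hδ : δ ≠ 0 := by
    rintro rfl; simp at h1; exact h0 h1.symm
  have hP : ((P.eval z : v.valuationSubring) : L) = 0 := by rw [hz.eq_zero]; rfl
  have hP2 : ((P.eval z : v.valuationSubring) : L) = z ^ (n+2) / q.coeff 0 * q.eval (δ / z) := by
    simp only [P, R, eval_add, eval_pow, eval_X, eval_finsetSum, eval_mul, eval_C]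
    push_cast
    rw [eval_eq_sum_range' (n := n + 3) (by omega), Finset.range_eq_Ico,
      Finset.sum_eq_sum_Ico_succ_bot (by omega), Finset.sum_eq_sum_Ico_succ_bot (by omega),
      mul_add, mul_add, Finset.mul_sum]
    congr 1
    · field_simp
    congr 1
    · rw [← h1] at h0 ⊢
      have : q.coeff 1 ≠ 0 := left_ne_zero_of_mul h0
      simp
      field_simp
      ring
    · refine Finset.sum_congr (by ext; simp; omega) fun k hk => ?_
      rw [Finset.mem_Ico] at hk
      rw [he k hk.1]
      have : (z:L) ^ (n+2) = z ^ (n + 2 - k) * z ^ k := by rw [← pow_add]; congr 1; omega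
      rw [this, div_pow]
      field_simp
  rw [hP2] at hP
  have := (mul_eq_zero.1 hP).resolve_left (div_ne_zero (pow_ne_zero _ hz0) h0)
  exact this

lemma splits_near {F : Type*} [Field F] [CharZero F] (d : ℕ) (e : (PowerSeries F)[X])
    (he : e.degree < d) :
    ((∏ j ∈ Finset.range d, (X - C (j : PowerSeries F)) + C PowerSeries.X * e).map
      (algebraMap (PowerSeries F) (LaurentSeries F))).Splits := by
  set h : (PowerSeries F)[X] := ∏ j ∈ Finset.range d, (X - C (j : PowerSeries F)) with hh
  have hhm : h.Monic := monic_prod_of_monic _ _ fun j _ => monic_X_sub_C _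
  have hhd : h.natDegree = d := by
    rw [hh, natDegree_prod_of_monic _ _ fun j _ => monic_X_sub_C _]; simp only [natDegree_X_sub_C]; simp
  have hhd' : h.degree = d := by rw [degree_eq_natDegree hhm.ne_zero, hhd]
  have hlt : (C (PowerSeries.X : PowerSeries F) * e).degree < h.degree := by
    rw [hhd']
    refine lt_of_le_of_lt ?_ he
    exact (degree_C_mul PowerSeries.X_ne_zero).le
  have hPm : (h + C PowerSeries.X * e).Monic := hhm.add_of_left hlt
  have hPd : (h + C PowerSeries.X * e).natDegree = d := by
    rw [natDegree_eq_of_degree_eq (degree_add_eq_left_of_degree_lt hlt), hhd]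
  set P := h + C PowerSeries.X * e with hP
  have key : ∀ j ∈ Finset.range d, ∃ r : PowerSeries F, P.IsRoot r ∧ r - j ∈ Ideal.span {(PowerSeries.X : PowerSeries F)} := by
    intro j hj
    apply HenselianRing.is_henselian P hPm
    · have : h.eval (j : PowerSeries F) = 0 := by
        rw [hh, eval_prod]; apply Finset.prod_eq_zero hj; simp
      rw [hP, eval_add, this, zero_add, eval_mul, eval_C]
      exact Ideal.mul_mem_right _ _ (Ideal.mem_span_singleton_self _)
    · have h1 : (derivative P).eval (j : PowerSeries F) = (∏ i ∈ (Finset.range d).erase j, ((j : PowerSeries F) - i)) + PowerSeries.X * (derivative e).eval (j : PowerSeries F) := by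
        rw [hP, derivative_add, eval_add, derivative_C_mul, eval_mul, eval_C]
        congr 1
        rw [hh, ← Finset.mul_prod_erase _ _ hj, derivative_mul, eval_add, eval_mul, eval_mul]
        simp [eval_prod]
      rw [h1]
      apply IsUnit.map
      rw [PowerSeries.isUnit_iff_constantCoeff]
      simp only [map_add, map_prod, map_sub, map_mul, PowerSeries.constantCoeff_X, zero_mul, add_zero, map_natCast]
      rw [isUnit_iff_ne_zero, Finset.prod_ne_zero_iff]
      intro i hi
      rw [sub_ne_zero]
      exact_mod_cast (Finset.ne_of_mem_erase hi).symm
  choose! r hr hr2 using key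
  have hrc : ∀ j ∈ Finset.range d, PowerSeries.constantCoeff (r j) = (j : F) := by
    intro j hj
    have := hr2 j hj
    rw [Ideal.mem_span_singleton, PowerSeries.X_dvd_iff] at this
    simpa [sub_eq_zero] using this
  let ι := algebraMap (PowerSeries F) (LaurentSeries F)
  have hι : Function.Injective ι := IsFractionRing.injective _ _
  rw [splits_iff_card_roots]
  apply le_antisymm (card_roots' _)
  rw [hPm.natDegree_map, hPd]
  classical
  have hinj : Set.InjOn (fun j => ι (r j)) (Finset.range d) := by
    intro i hi j hj hij
    have := hι hij
    have h2 := hrc i hi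
    rw [this, hrc j hj] at h2
    exact_mod_cast h2.symm
  have hcard : ((Finset.range d).image (fun j => ι (r j))).card = d := by
    rw [Finset.card_image_of_injOn hinj, Finset.card_range]
  have hsub : ((Finset.range d).image (fun j => ι (r j))).val ≤ (P.map ι).roots := by
    rw [Multiset.le_iff_subset (Finset.nodup _)]
    intro x hx
    rw [Finset.mem_val, Finset.mem_image] at hx
    obtain ⟨j, hj, rfl⟩ := hx
    rw [mem_roots (hPm.map _).ne_zero]
    exact (hr j hj).map
  calc d = _ := hcard.symm
    _ ≤ _ := Multiset.card_le_card hsub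

lemma exists_coeff_bound {L Γ₀ : Type*} [Field L]
    [LinearOrderedCommGroupWithZero Γ₀] (v : Valuation L Γ₀) (p : L[X]) :
    ∃ β : L, 1 ≤ v β ∧ ∀ k, v (p.coeff k) ≤ v β := by
  classical
  obtain ⟨β, hβ, hmax⟩ := Finset.exists_max_image
    (insert 1 ((Finset.range (p.natDegree + 1)).image p.coeff)) v ⟨1, by simp⟩
  refine ⟨β, by simpa using hmax 1 (by simp), fun k => ?_⟩
  by_cases hk : k ≤ p.natDegree
  · exact hmax _ (Finset.mem_insert_of_mem (Finset.mem_image_of_mem _ (by simpa [Nat.lt_succ_iff] using hk)))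
  · rw [coeff_eq_zero_of_natDegree_lt (by omega)]; simp

lemma exists_newton_close {L Γ₀ : Type*} [Field L]
    [LinearOrderedCommGroupWithZero Γ₀] (v : Valuation L Γ₀)
    (hhens : HenselianLocalRing ↥v.valuationSubring) (f r : L[X]) (a : L)
    (hf : f.eval a = 0) (hf' : (derivative f).eval a ≠ 0) (hr : r.eval a ≠ 0)
    (ε : L) (hε : ε ≠ 0) :
    ∃ γ : L, 1 ≤ v γ ∧ ∀ c : L, c ≠ 0 → v (c * γ) < 1 →
      ∃ b, (f + C c * r).IsRoot b ∧ v (a - b) ≤ v ε := by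
  set f₁ := (derivative f).eval a with hf₁
  obtain ⟨β₁, hβ₁, hb₁⟩ := exists_coeff_bound v (C f₁⁻¹ * taylor a f)
  obtain ⟨β₂, hβ₂, hb₂⟩ := exists_coeff_bound v (C f₁⁻¹ * taylor a r)
  obtain ⟨β₃, hβ₃, hb₃⟩ := exists_coeff_bound v (C ε⁻¹)
  have hb₃' := hb₃ 0
  simp only [coeff_C_zero] at hb₃'
  simp only [coeff_C_mul] at hb₁ hb₂
  obtain ⟨β, hβdef⟩ : ∃ β, β = β₁ * β₂ := ⟨_, rfl⟩
  have hβ : 1 ≤ v β := by rw [hβdef, map_mul]; exact one_le_mul hβ₁ hβ₂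
  replace hb₁ : ∀ k, v (f₁⁻¹ * (taylor a f).coeff k) ≤ v β := fun k =>
    (hb₁ k).trans (by rw [hβdef, map_mul]; exact le_mul_of_one_le_right' hβ₂)
  replace hb₂ : ∀ k, v (f₁⁻¹ * (taylor a r).coeff k) ≤ v β := fun k =>
    (hb₂ k).trans (by rw [hβdef, map_mul]; exact le_mul_of_one_le_left' hβ₁)
  refine ⟨β ^ 2 * β₃, ?_, fun c hc hcγ => ?_⟩
  · rw [map_mul, map_pow]; exact one_le_mul (one_le_pow₀ hβ) hβ₃
  have hcβ2 : v c * v β ^ 2 < 1 := by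
    refine lt_of_le_of_lt ?_ hcγ
    rw [map_mul, map_mul, map_pow, ← mul_assoc]
    exact le_mul_of_one_le_right' hβ₃
  have hcβ : v c * v β < 1 := by
    refine lt_of_le_of_lt ?_ hcβ2
    rw [pow_two, ← mul_assoc]
    exact le_mul_of_one_le_right' hβ
  have hc1 : v c ≤ 1 := by
    refine le_trans ?_ hcβ.le
    exact le_mul_of_one_le_right' hβ
  have hcε : v c * v β ≤ v ε := by
    have h1 : v c * v β * v β₃ ≤ 1 := by
      refine le_trans ?_ hcγ.le
      rw [map_mul, map_mul, map_pow, pow_two, ← mul_assoc, ← mul_assoc]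
      gcongr
      exact le_mul_of_one_le_right' hβ
    have h2 : v c * v β * v ε⁻¹ ≤ 1 := le_trans (by gcongr) h1
    rw [map_inv₀] at h2
    rwa [← div_eq_mul_inv, div_le_one₀ (zero_lt_iff.2 ((Valuation.ne_zero_iff v).2 hε))] at h2
  set q := taylor a (f + C c * r) with hq
  have hqk : ∀ k, q.coeff k = (taylor a f).coeff k + c * (taylor a r).coeff k := by
    intro k; rw [hq, map_add, taylor_mul, taylor_C, coeff_add, coeff_C_mul]
  have hq0 : q.coeff 0 = c * r.eval a := by
    rw [hqk, taylor_coeff_zero, taylor_coeff_zero, hf, zero_add]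
  have hq0' : q.coeff 0 ≠ 0 := by rw [hq0]; exact mul_ne_zero hc hr
  have hvf1 : (0 : Γ₀) < v f₁ := zero_lt_iff.2 ((Valuation.ne_zero_iff v).2 hf')
  have hq1 : v (q.coeff 1) = v f₁ := by
    rw [hqk, taylor_coeff_one, ← hf₁]
    apply Valuation.map_add_eq_of_lt_left
    have h3 := hb₂ 1
    have : c * (taylor a r).coeff 1 = f₁ * (c * (f₁⁻¹ * (taylor a r).coeff 1)) := by field_simp
    rw [this, map_mul]
    refine mul_lt_of_lt_one_right hvf1 ?_
    rw [map_mul]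
    exact lt_of_le_of_lt (by gcongr) hcβ
  have hq1' : q.coeff 1 ≠ 0 := by
    rw [← Valuation.ne_zero_iff v, hq1]; exact hvf1.ne'
  have hδ : v (q.coeff 0 / q.coeff 1) ≤ v c * v β := by
    rw [map_div₀, hq1, ← map_div₀, hq0]
    have h3 := hb₂ 0
    rw [taylor_coeff_zero] at h3
    have : c * r.eval a / f₁ = c * (f₁⁻¹ * r.eval a) := by field_simp
    rw [this, map_mul]
    gcongr
  obtain ⟨y, hy, hvy⟩ := newton_root v hhens q (q.coeff 0 / q.coeff 1) hq0' (by field_simp) (by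
    intro k hk
    obtain ⟨l, rfl⟩ : ∃ l, k = l + 2 := ⟨k - 2, by omega⟩
    have h4 : q.coeff (l+2) * (q.coeff 0 / q.coeff 1) ^ (l+2) / q.coeff 0 =
      q.coeff (l+2) / q.coeff 1 * (q.coeff 0 / q.coeff 1) ^ (l+1) := by
      rw [pow_succ]; field_simp
    have h5 : v (q.coeff (l+2) / q.coeff 1) ≤ v β := by
      rw [map_div₀, hq1, ← map_div₀, hqk]
      have : ((taylor a f).coeff (l+2) + c * (taylor a r).coeff (l+2)) / f₁ =
        f₁⁻¹ * (taylor a f).coeff (l+2) + c * (f₁⁻¹ * (taylor a r).coeff (l+2)) := by field_simp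
      rw [this]
      refine Valuation.map_add_le _ (hb₁ _) ?_
      rw [map_mul]
      exact le_trans (mul_le_of_le_one_left' hc1) (hb₂ _)
    rw [h4, map_mul, map_pow]
    calc _ ≤ v β * (v c * v β) ^ (l+1) := by gcongr
      _ ≤ v β * (v c * v β) := by
        gcongr
        exact pow_le_of_le_one zero_le hcβ.le (by omega)
      _ = v c * v β ^ 2 := by rw [mul_left_comm, pow_two]
      _ < 1 := hcβ2)
  refine ⟨y + a, ?_, ?_⟩
  · have := hy.eq_zero
    rw [hq, taylor_eval] at this
    exact this
  · have : a - (y + a) = -y := by ring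
    rw [this, Valuation.map_neg, hvy]
    exact hδ.trans hcε

lemma step_close {K L Γ₀ F : Type*} [Field K] [Field L] [Algebra K L] [Field F] [CharZero F]
    [LinearOrderedCommGroupWithZero Γ₀] (v : Valuation L Γ₀) [Algebra.IsAlgebraic K L]
    (hhens : HenselianLocalRing ↥v.valuationSubring)
    (φ : K →+* LaurentSeries F) (τ : K)
    (hτ : φ τ = algebraMap (PowerSeries F) (LaurentSeries F) PowerSeries.X)
    (hvτ : 1 < v (algebraMap K L τ)) (a : L) (ha : a ∉ Set.range (algebraMap K L))
    (ε : L) (hε : ε ≠ 0) :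
    ∃ b : L, v (a - b) ≤ v ε ∧ ((minpoly K b).map φ).Splits := by
  have : CharZero (LaurentSeries F) := charZero_of_injective_algebraMap (algebraMap F (LaurentSeries F)).injective
  have hK : CharZero K := ⟨fun m n h => by
    have := congrArg φ h
    simpa using this⟩
  have hIntegral : IsIntegral K a := Algebra.IsIntegral.isIntegral a
  set f := minpoly K a with hf
  have hfm : f.Monic := minpoly.monic hIntegral
  set d := f.natDegree with hd
  set h : K[X] := ∏ j ∈ Finset.range d, (X - C (j : K)) with hh
  have hhm : h.Monic := monic_prod_of_monic _ _ fun j _ => monic_X_sub_C _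
  have hhd : h.natDegree = d := by
    rw [hh, natDegree_prod_of_monic _ _ fun j _ => monic_X_sub_C _]; simp only [natDegree_X_sub_C]; simp
  have hhd' : h.degree = d := by rw [degree_eq_natDegree hhm.ne_zero, hhd]
  have hfd' : f.degree = d := by rw [degree_eq_natDegree hfm.ne_zero]
  have hdeg : (f - h).degree < d := by
    rw [← hfd']
    exact degree_sub_lt_left (hfd'.trans hhd'.symm) hfm.ne_zero (by rw [hfm.leadingCoeff, hhm.leadingCoeff])
  let ι := algebraMap (PowerSeries F) (LaurentSeries F)
  have hι : Function.Injective ι := IsFractionRing.injective _ _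
  -- clearing denominators
  obtain ⟨N, E, hE⟩ : ∃ (N : ℕ) (E : (PowerSeries F)[X]),
      E.map ι = C (ι (PowerSeries.X ^ N)) * (f - h).map φ := by
    obtain ⟨b, ⟨N, hN⟩, hb2⟩ := IsLocalization.integerNormalization_spec
      (Submonoid.powers (PowerSeries.X : PowerSeries F)) ((f - h).map φ)
    refine ⟨N, _, hb2.trans ?_⟩
    rw [← hN]
    ext1 k
    rw [coeff_C_mul, coeff_smul, Algebra.smul_def]
  have hEdeg : E.degree < d := by
    rw [← degree_map_eq_of_injective hι, hE]
    refine lt_of_le_of_lt ?_ hdeg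
    rw [degree_C_mul ((map_ne_zero_iff ι hι).2 (pow_ne_zero _ PowerSeries.X_ne_zero))]
    exact degree_map_le
  have hfa : (f.map (algebraMap K L)).eval a = 0 := by
    rw [eval_map_algebraMap]; exact minpoly.aeval K a
  have hfa' : (derivative (f.map (algebraMap K L))).eval a ≠ 0 := by
    rw [derivative_map, eval_map_algebraMap]
    exact (minpoly.irreducible hIntegral).separable.aeval_derivative_ne_zero (minpoly.aeval K a)
  have hra : ((h - f).map (algebraMap K L)).eval a ≠ 0 := by
    rw [Polynomial.map_sub, eval_sub, hfa, sub_zero, eval_map_algebraMap, hh, map_prod, Finset.prod_ne_zero_iff]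
    intro j _ h0
    rw [map_sub, aeval_X, aeval_C, sub_eq_zero] at h0
    exact ha ⟨_, h0.symm⟩
  obtain ⟨γ, hγ, hclose⟩ := exists_newton_close v hhens _ _ a hfa hfa' hra ε hε
  have hγτ : 1 < v (γ * algebraMap K L τ) := by
    rw [map_mul]; exact lt_of_lt_of_le hvτ (le_mul_of_one_le_left' hγ)
  obtain ⟨m, hm⟩ := cofinal_of_algebraic (K := K) v (γ * algebraMap K L τ) hγτ.le
  obtain ⟨⟨α, ⟨_, j, rfl⟩⟩, hα⟩ := IsLocalization.surj (Submonoid.powers (PowerSeries.X : PowerSeries F)) (φ m)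
  simp only at hα
  set y := m * τ ^ (j + (N + 1)) with hy
  have hφy : φ y = ι (PowerSeries.X ^ (N+1) * α) := by
    rw [hy, map_mul, map_pow, hτ, map_mul, ← hα, map_pow, map_pow, pow_add]
    ring
  have hvy : v (γ * algebraMap K L τ) ≤ v (algebraMap K L y) := by
    refine hm.trans ?_
    rw [hy, map_mul, map_mul, map_pow, map_pow]
    exact le_mul_of_one_le_right' (one_le_pow₀ hvτ.le)
  have hvy1 : 1 < v (algebraMap K L y) := lt_of_lt_of_le hγτ hvy
  have hv1y : v (algebraMap K L (1 + y)) = v (algebraMap K L y) := by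
    rw [map_add, map_one]
    exact Valuation.map_add_eq_of_lt_right v (by simpa using hvy1)
  have h1y : 1 + y ≠ 0 := by
    intro h0
    rw [h0] at hv1y
    rw [← hv1y] at hvy1
    simp at hvy1
  set c := (1 + y)⁻¹ with hc
  have hc0 : c ≠ 0 := inv_ne_zero h1y
  obtain ⟨b, hb, hab⟩ := hclose (algebraMap K L c) (by simpa using hc0) (by
    rw [hc, map_inv₀, map_mul, map_inv₀, hv1y, mul_comm, ← div_eq_mul_inv,
      div_lt_one₀ (zero_lt_one.trans hvy1)]
    refine lt_of_lt_of_le ?_ hvy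
    rw [map_mul]
    exact lt_mul_of_one_lt_right (zero_lt_one.trans_le hγ) hvτ)
  refine ⟨b, hab, ?_⟩
  set g := f + C c * (h - f) with hg
  have hgb : aeval b g = 0 := by
    rw [← eval_map_algebraMap, hg]
    simpa using hb
  have hgm : g.Monic := by
    apply hfm.add_of_left
    rw [degree_C_mul hc0, ← degree_neg, neg_sub, hfd']
    exact hdeg
  have hdvd : (minpoly K b).map φ ∣ g.map φ := Polynomial.map_dvd _ (minpoly.dvd K b hgb)
  refine Splits.of_dvd ?_ (hgm.map φ).ne_zero hdvd
  have hunit : IsUnit (1 + PowerSeries.X ^ (N+1) * α : PowerSeries F) := by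
    rw [PowerSeries.isUnit_iff_constantCoeff]
    simp
  obtain ⟨u, hu⟩ := hunit.exists_right_inv
  have hφc : φ c = ι u := by
    rw [hc, map_inv₀, map_add, map_one, hφy]
    apply inv_eq_of_mul_eq_one_right
    rw [← map_one ι, ← map_add, ← map_mul, hu]
  have h1c : 1 - φ c = ι (PowerSeries.X ^ (N+1) * α * u) := by
    rw [hφc, ← map_one ι, ← map_sub]
    congr 1
    rw [← hu]; ring
  have hfin : g.map φ = (∏ j ∈ Finset.range d, (X - C (j : PowerSeries F)) + C PowerSeries.X * (C (α * u) * E)).map ι := by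
    have e1 : (∏ j ∈ Finset.range d, (X - C (j : PowerSeries F))).map ι = h.map φ := by
      rw [hh, Polynomial.map_prod, Polynomial.map_prod]; simp
    have e2 : g = h + C (1 - c) * (f - h) := by
      rw [hg, C_sub, C_1]; ring
    rw [e2, Polynomial.map_add, Polynomial.map_add, e1]
    congr 1
    rw [Polynomial.map_mul, map_C, map_sub, map_one, h1c, Polynomial.map_mul, Polynomial.map_mul, hE, map_C, map_C,
      ← mul_assoc, ← mul_assoc, ← C_mul, ← C_mul, ← map_mul, ← map_mul]
    congr 3
    ring
  rw [hfin]
  apply splits_near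
  refine lt_of_le_of_lt ?_ hEdeg
  rw [degree_mul]
  calc _ ≤ 0 + E.degree := by gcongr; exact degree_C_le
    _ = _ := zero_add _

lemma laurent_not_square {F : Type*} [Field F] (s : LaurentSeries F) :
    s ^ 2 * algebraMap (PowerSeries F) (LaurentSeries F) PowerSeries.X ≠
      algebraMap (PowerSeries F) (LaurentSeries F) (1 + PowerSeries.X) := by
  intro hs
  obtain ⟨⟨α, ⟨_, j, rfl⟩⟩, hα⟩ :=
    IsLocalization.surj (Submonoid.powers (PowerSeries.X : PowerSeries F)) s
  simp only at hα
  have h1 : α ^ 2 * PowerSeries.X = (1 + PowerSeries.X) * PowerSeries.X ^ (2 * j) := by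
    apply IsFractionRing.injective (PowerSeries F) (LaurentSeries F)
    rw [map_mul, map_mul, ← hs, map_pow, ← hα, pow_mul', map_pow _ (PowerSeries.X ^ j)]
    ring
  have h2 := congrArg PowerSeries.order h1
  have h3 : (1 + PowerSeries.X : PowerSeries F).order = 0 := by
    by_contra h
    have := PowerSeries.order_ne_zero_iff_constCoeff_eq_zero.1 h
    simp at this
  rw [PowerSeries.order_mul, PowerSeries.order_mul, PowerSeries.order_pow, PowerSeries.order_X_pow, h3, PowerSeries.order_X] at h2
  cases h : α.order with
  | top => rw [h] at h2; simp at h2; exact absurd h2.symm (by exact_mod_cast ENat.natCast_ne_top (2 * j))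
  | coe n =>
    rw [h] at h2
    simp at h2
    norm_cast at h2
    omega

open scoped RatFunc in
lemma exists_dense_of_ratFunc {F L Γ₀ : Type*} [Field F] [CharZero F] [Field L]
    [Algebra (RatFunc F) L] [Algebra.IsAlgebraic (RatFunc F) L]
    [LinearOrderedCommGroupWithZero Γ₀] (v : Valuation L Γ₀)
    (hhens : HenselianLocalRing ↥v.valuationSubring)
    (hvt : 1 < v (algebraMap (RatFunc F) L RatFunc.X))
    (s : L) (hs : s ^ 2 * algebraMap (RatFunc F) L RatFunc.X = 1 + algebraMap (RatFunc F) L RatFunc.X) :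
    ∃ K : Subfield L, K ≠ ⊤ ∧ v.DenseSubfield K ∧ Algebra.IsAlgebraic ↥K L := by
  have hXX : algebraMap (RatFunc F) (LaurentSeries F) RatFunc.X =
      algebraMap (PowerSeries F) (LaurentSeries F) PowerSeries.X := by
    rw [RatFunc.coe_X]
    exact (HahnSeries.ofPowerSeries_X).symm
  obtain ⟨Λ, hΛ⟩ := zorn_le (α := IntermediateField.Lifts (RatFunc F) L (LaurentSeries F))
    fun c hc => IntermediateField.Lifts.exists_upper_bound c hc
  have halg : Algebra.IsAlgebraic Λ.carrier L := Algebra.IsAlgebraic.tower_top (K := RatFunc F) Λ.carrier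
  refine ⟨Λ.carrier.toSubfield, ?_, ?_, halg⟩
  · intro htop
    have hsm : s ∈ Λ.carrier := by
      have : s ∈ Λ.carrier.toSubfield := by rw [htop]; trivial
      exact this
    apply laurent_not_square (Λ.emb ⟨s, hsm⟩)
    rw [map_add, map_one, ← hXX, ← Λ.emb.commutes, ← map_pow, ← map_mul, ← map_one Λ.emb, ← map_add]
    congr 1
    exact Subtype.ext hs
  · intro a c hc
    by_cases ha : a ∈ Λ.carrier
    · exact ⟨a, ha, by simp⟩
    obtain ⟨b, hb, hsp⟩ := step_close (K := Λ.carrier) v hhens Λ.emb.toRingHom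
      (algebraMap (RatFunc F) Λ.carrier RatFunc.X) ((Λ.emb.commutes _).trans hXX)
      (by rwa [← IsScalarTower.algebraMap_apply]) a (by
        rintro ⟨x, rfl⟩; exact ha x.2) c hc
    obtain ⟨Λ', hle, hmem⟩ := Λ.exists_lift_of_splits' (Algebra.IsIntegral.isIntegral b) hsp
    exact ⟨b, (hΛ hle).1 hmem, hb⟩

open scoped IntermediateField.algebraAdjoinAdjoin in
lemma transcendental_adjoin_field {L : Type*} [Field L] [Algebra ℚ L] (S : Set L) (t : L)
    (h : Transcendental (Algebra.adjoin ℚ S) t) :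
    Transcendental (IntermediateField.adjoin ℚ S) t := fun h3 =>
  h ((IsFractionRing.isAlgebraic_iff (Algebra.adjoin ℚ S) (IntermediateField.adjoin ℚ S) L).2 h3)

/-- Every henselian non-trivially valued field `(L,v)` whose residue field has
characteristic `0` admits a proper subfield `K` which is dense in `(L,v)`; moreover
`K` can be chosen with `L/K` algebraic. -/
theorem exists_proper_dense_subfield {L : Type*} [Field L] {Γ₀ : Type*}
    [LinearOrderedCommGroupWithZero Γ₀] (v : Valuation L Γ₀)
    (hhens : HenselianLocalRing ↥v.valuationSubring)
    (hnontriv : ∃ x : L, x ≠ 0 ∧ v x ≠ 1)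
    (hchar : CharZero (ResidueField ↥v.valuationSubring)) :
    ∃ K : Subfield L, K ≠ ⊤ ∧ v.DenseSubfield K ∧ Algebra.IsAlgebraic ↥K L := by
  -- integers are units
  have hnat : ∀ n : ℕ, n ≠ 0 → IsUnit (n : v.valuationSubring) := by
    intro n hn
    by_contra hcon
    have h1 := (residue_eq_zero_iff (n : v.valuationSubring)).2 ((mem_maximalIdeal _).2 hcon)
    rw [map_natCast] at h1
    exact hn (by exact_mod_cast h1)
  have hvnat : ∀ n : ℕ, n ≠ 0 → v (n : L) = 1 := by
    intro n hn
    rw [v.isEquiv_valuation_valuationSubring.eq_one_iff_eq_one]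
    have := (ValuationSubring.valuation_eq_one_iff _ _).1 (hnat n hn)
    simpa using this
  have hL : CharZero L := charZero_of_inj_zero fun n hn => by
    by_contra h
    have := hvnat n h
    rw [hn] at this
    simp at this
  have hvrat : ∀ r : ℚ, v (algebraMap ℚ L r) ≤ 1 := by
    intro r
    rw [eq_ratCast, Rat.cast_def, map_div₀, hvnat _ r.den_nz, div_one]
    obtain ⟨n, hn | hn⟩ := r.num.eq_nat_or_neg
    all_goals
      rw [hn]
      by_cases h0 : n = 0
      · simp [h0]
      · simp [hvnat n h0, Valuation.map_neg]
  obtain ⟨t, ht⟩ : ∃ t : L, 1 < v t := by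
    obtain ⟨x, hx0, hx⟩ := hnontriv
    rcases lt_or_gt_of_ne hx with h | h
    · refine ⟨x⁻¹, ?_⟩
      rw [map_inv₀]
      exact (one_lt_inv₀ (zero_lt_iff.2 ((Valuation.ne_zero_iff v).2 hx0))).2 h
    · exact ⟨x, h⟩
  have ht0 : t ≠ 0 := by rintro rfl; simp at ht
  have httr : Transcendental ℚ t := by
    intro halg
    have : Algebra.IsAlgebraic ℚ (IntermediateField.adjoin ℚ {t}) :=
      IntermediateField.isAlgebraic_adjoin_simple halg.isIntegral
    obtain ⟨m, hm⟩ := cofinal_of_algebraic (K := ℚ)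
      (v.comap (algebraMap (IntermediateField.adjoin ℚ {t}) L))
      ⟨t, IntermediateField.mem_adjoin_simple_self ℚ t⟩ (by simpa using ht.le)
    have h2 : v t ≤ v (algebraMap ℚ L m) := hm
    exact absurd (ht.trans_le (h2.trans (hvrat m))) (lt_irrefl _)
  -- square root of `1 + 1/t`
  obtain ⟨s, hs⟩ : ∃ s : L, s ^ 2 * t = 1 + t := by
    have htm : v t⁻¹ < 1 := by
      rw [map_inv₀]; exact inv_lt_one_of_one_lt₀ ht
    let w : v.valuationSubring := ⟨t⁻¹, (Valuation.mem_valuationSubring_iff _ _).2 htm.le⟩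
    have hw : w ∈ maximalIdeal v.valuationSubring := by
      rw [ValuationSubring.valuation_lt_one_iff,
        ← v.isEquiv_valuation_valuationSubring.lt_one_iff_lt_one]
      exact htm
    obtain ⟨z, hz, -⟩ := HenselianLocalRing.is_henselian (X ^ 2 - C (1 + w))
      (monic_X_pow_sub_C _ (by norm_num)) 1 (by
        simp only [eval_sub, eval_pow, eval_X, eval_C]
        have : (1 : v.valuationSubring) ^ 2 - (1 + w) = -w := by ring
        rw [this]; exact neg_mem hw) (by
        have := hnat 2 (by norm_num)
        simpa [one_add_one_eq_two] using this)
    refine ⟨z, ?_⟩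
    have h1 : z ^ 2 = 1 + w := by
      have := hz.eq_zero
      simpa [sub_eq_zero] using this
    have h2 : (z : L) ^ 2 = 1 + t⁻¹ := by
      have := congrArg (Subtype.val) h1
      simpa using this
    rw [h2]; field_simp; ring
  -- transcendence basis
  obtain ⟨T, htT, hT⟩ := exists_isTranscendenceBasis_superset (R := ℚ) (s := {t})
    ((algebraicIndependent_singleton_iff (R := ℚ) (x := fun i : ({t} : Set L) => (i : L)) ⟨t, rfl⟩).2 httr)
  have htT' : t ∈ T := htT rfl
  let F := IntermediateField.adjoin ℚ (T \ {t})
  have htF : Transcendental F t := by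
    have h1 : AlgebraicIndepOn ℚ id (insert t (T \ {t})) := by
      rw [Set.insert_sdiff_singleton, Set.insert_eq_of_mem htT']
      exact hT.1
    have h2 := ((AlgebraicIndepOn.insert_iff (by simp)).1 h1).2
    rw [Set.image_id] at h2
    exact transcendental_adjoin_field _ _ h2
  have hinj : Function.Injective (aeval (R := F) t) := transcendental_iff_injective.1 htF
  let toL : RatFunc F →+* L := RatFunc.liftRingHom (aeval (R := F) t).toRingHom
    (nonZeroDivisors_le_comap_nonZeroDivisors_of_injective _ hinj)
  have htoX : toL RatFunc.X = t := by
    simp [toL, RatFunc.liftRingHom_X]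
  have htoC : ∀ x : F, toL (RatFunc.C x) = x := by
    intro x
    simp only [toL, ← RatFunc.algebraMap_C]
    rw [RatFunc.liftRingHom_algebraMap]
    simp
  let _ : Algebra (RatFunc F) L := toL.toAlgebra
  have hle : ∀ y ∈ IntermediateField.adjoin ℚ T, y ∈ toL.fieldRange := by
    have : IntermediateField.adjoin ℚ T ≤ Subfield.toIntermediateField (K := ℚ) toL.fieldRange (fun r => ⟨(r : RatFunc F), by rw [map_ratCast, eq_ratCast]⟩) := by
      rw [IntermediateField.adjoin_le_iff]
      intro x hx
      by_cases hxt : x = t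
      · exact ⟨RatFunc.X, htoX.trans hxt.symm⟩
      · exact ⟨RatFunc.C ⟨x, IntermediateField.subset_adjoin _ _ ⟨hx, hxt⟩⟩, htoC _⟩
    exact fun y hy => this hy
  have halg : Algebra.IsAlgebraic (RatFunc F) L := by
    have h1 := hT.isAlgebraic_field
    rw [Subtype.range_coe] at h1
    choose! g hg using hle
    let G : IntermediateField.adjoin ℚ T →+* RatFunc F :=
      { toFun := fun y => g y
        map_one' := toL.injective ((hg _ (one_mem _)).trans (map_one toL).symm)
        map_zero' := toL.injective ((hg _ (zero_mem _)).trans (map_zero toL).symm)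
        map_mul' := fun x y => toL.injective (by
          rw [map_mul, hg _ x.2, hg _ y.2]; exact hg _ (mul_mem x.2 y.2))
        map_add' := fun x y => toL.injective (by
          rw [map_add, hg _ x.2, hg _ y.2]; exact hg _ (add_mem x.2 y.2)) }
    refine ⟨fun x => ?_⟩
    obtain ⟨p, hp, hpx⟩ := h1.1 x
    refine ⟨p.map G, (Polynomial.map_ne_zero_iff G.injective).2 hp, ?_⟩
    rw [aeval_def, eval₂_map]
    have : (algebraMap (RatFunc F) L).comp G = algebraMap (IntermediateField.adjoin ℚ T) L := by
      ext y
      exact hg _ y.2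
    rw [this]
    exact hpx
  have hX : algebraMap (RatFunc F) L RatFunc.X = t := htoX
  exact exists_dense_of_ratFunc (F := F) v hhens (by rw [hX]; exact ht) s (by rw [hX]; exact hs)
end
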